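/- There exist an absolute constant C > 0, an absolute constant N₀, and for each integer d ≥ 1 a constant K_d (one may take K_d = (C·d)^d) with the following property. Let k ≥ 2 be an integer, A > 0 a real number, n ≥ N₀, and let f : {0,1}^m → {0,1}^n be a d-local function such that no input bit affects more than n/A output bits, and suppose there is a set S ⊆ [n] with |S| ≤ √(n/A) such that f(U^m) is k-wise independent on [n]∖S. Then there exists η ∈ [0,1] such that for every δ ∈ (0,1/2) and every t ∈ ℝ, both |Pr[|f(U^m)| > t and |f(U^m)| is even] − η·Pr[|U^n| > t]| and |Pr[|f(U^m)| > t and |f(U^m)| is odd] − (1−η)·Pr[|U^n| > t]| are at most C·( (log(1/δ))^{K_d}/√(A·δ) + log(k)/√k + δ ). -/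

import Mathlib

open Finset

noncomputable section

/-- Hamming weight of a Boolean string. -/
def hw {n : ℕ} (x : Fin n → Bool) : ℕ := (Finset.univ.filter fun i => x i = true).card

/-- Uniform distribution on a finite set `C` (zero if `C` is empty). -/
def unifOn {α : Type} [Fintype α] [DecidableEq α] (C : Finset α) : α → ℝ :=
  fun x => if x ∈ C then (C.card : ℝ)⁻¹ else 0

/-- Total variation distance between two (mass functions of) distributions. -/
def tvd {α : Type} [Fintype α] (A B : α → ℝ) : ℝ := (∑ x, |A x - B x|) / 2

/-- Pushforward of a distribution along `f`. -/
def pushf {α β : Type} [Fintype α] [DecidableEq β] (f : α → β) (A : α → ℝ) : β → ℝ :=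
  fun y => ∑ x ∈ Finset.univ.filter (fun x => f x = y), A x

/-- `f` is `d`-local: each output coordinate depends on at most `d` input coordinates. -/
def IsLocal {m n : ℕ} (d : ℕ) (f : (Fin m → Bool) → (Fin n → Bool)) : Prop :=
  ∀ i : Fin n, ∃ T : Finset (Fin m), T.card ≤ d ∧
    ∀ x y : Fin m → Bool, (∀ j ∈ T, x j = y j) → f x i = f y i

/-- `D_Ψ`: uniform distribution on strings whose Hamming weight lies in `Ψ`. -/
def DPsi (n : ℕ) (Ψ : Finset ℕ) : (Fin n → Bool) → ℝ :=
  unifOn (Finset.univ.filter fun x => hw x ∈ Ψ)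

/-- The weight distribution of `A`: probability that the Hamming weight equals `k`. -/
def wd {n : ℕ} (A : (Fin n → Bool) → ℝ) (k : ℕ) : ℝ :=
  ∑ x ∈ Finset.univ.filter (fun x => hw x = k), A x

/-- Total variation distance between the weight distributions of `A` and `B`. -/
def tvW {n : ℕ} (A B : (Fin n → Bool) → ℝ) : ℝ :=
  (∑ k ∈ Finset.range (n + 1), |wd A k - wd B k|) / 2

/-- Symmetrization of the distribution `A`. -/
def symA {n : ℕ} (A : (Fin n → Bool) → ℝ) : (Fin n → Bool) → ℝ :=
  fun x => wd A (hw x) / (n.choose (hw x))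

/-- Input bit `j` affects output bit `i` of `f`. -/
def Affects {m n : ℕ} (f : (Fin m → Bool) → (Fin n → Bool)) (j : Fin m) (i : Fin n) : Prop :=
  ∃ x : Fin m → Bool, f x i ≠ f (Function.update x j (!(x j))) i

/-- `D` is `k`-wise independent on the coordinate set `T`. -/
def KWiseOn {n : ℕ} (k : ℕ) (D : (Fin n → Bool) → ℝ) (T : Finset (Fin n)) : Prop :=
  ∀ T' ⊆ T, T'.card ≤ k → ∀ z : Fin n → Bool,
    (∑ y ∈ Finset.univ.filter (fun y : Fin n → Bool => ∀ i ∈ T', y i = z i), D y)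
      = ((2 : ℝ) ^ T'.card)⁻¹

section Library

open scoped BigOperators

section Phase

set_option linter.unusedSectionVars false

variable {ι : Type} [Fintype ι] [DecidableEq ι]

/-- The sign `(-1)^b` of a bit. -/
def sg (b : Bool) : ℝ := if b then -1 else 1

/-- Coordinatewise exclusive or. -/
def xo (x y : ι → Bool) : ι → Bool := fun j => xor (x j) (y j)

/-- The string that agrees with `y` on `Q` and with `x` off `Q`. -/
def mix (Q : Finset ι) (x y : ι → Bool) : ι → Bool := fun j => if j ∈ Q then y j else x j

/-- `±1`-valued functions on the cube annihilated by `d + 1` multiplicative derivatives. -/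
def PhaseDeg : ℕ → ((ι → Bool) → ℝ) → Prop
  | 0, G => (∀ x, G x * G x = 1) ∧ ∀ x y, G x = G y
  | d + 1, G => (∀ x, G x * G x = 1) ∧ ∀ y, PhaseDeg d (fun x => G x * G (xo x y))

lemma sg_mul_self (b : Bool) : sg b * sg b = 1 := by cases b <;> simp [sg]

lemma sg_xor (a b : Bool) : sg (xor a b) = sg a * sg b := by cases a <;> cases b <;> simp [sg]

lemma sg_not (b : Bool) : sg (!b) = -sg b := by cases b <;> simp [sg]

lemma abs_sg (b : Bool) : |sg b| = 1 := by cases b <;> simp [sg]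

lemma xo_apply (x y : ι → Bool) (j : ι) : xo x y j = xor (x j) (y j) := rfl

lemma xo_xo (x y : ι → Bool) : xo (xo x y) y = x := by funext j; simp [xo]

lemma xo_comm (x y : ι → Bool) : xo x y = xo y x := by funext j; simp [xo, Bool.xor_comm]

lemma expect_xo (F : (ι → Bool) → ℝ) (y : ι → Bool) : 𝔼 x, F (xo x y) = 𝔼 x, F x :=
  Fintype.expect_equiv ⟨fun x => xo x y, fun x => xo x y, fun x => xo_xo x y, fun x => xo_xo x y⟩
    _ _ fun _ => rfl

lemma expect_xo_right (F : (ι → Bool) → ℝ) (y : ι → Bool) : 𝔼 x, F (xo y x) = 𝔼 x, F x := by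
  simp_rw [xo_comm y]; exact expect_xo F y

namespace PhaseDeg

lemma sq {d : ℕ} {G : (ι → Bool) → ℝ} (h : PhaseDeg d G) : ∀ x, G x * G x = 1 := by
  cases d <;> exact h.1

lemma abs_eq {d : ℕ} {G : (ι → Bool) → ℝ} (h : PhaseDeg d G) (x : ι → Bool) : |G x| = 1 := by
  have := h.sq x
  rcases mul_self_eq_one_iff.1 this with h | h <;> simp [h]

lemma mul {d : ℕ} {G H : (ι → Bool) → ℝ} (hG : PhaseDeg d G) (hH : PhaseDeg d H) :
    PhaseDeg d (fun x => G x * H x) := by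
  induction d generalizing G H with
  | zero =>
    refine ⟨fun x => ?_, fun x y => ?_⟩
    · linear_combination H x * H x * hG.1 x + hH.1 x
    · simp only [hG.2 x y, hH.2 x y]
  | succ d ih =>
    refine ⟨fun x => ?_, fun y => ?_⟩
    · linear_combination H x * H x * hG.1 x + hH.1 x
    · have := ih (hG.2 y) (hH.2 y)
      convert this using 2 with x
      ring

lemma one (d : ℕ) : PhaseDeg d (fun _ : ι → Bool => (1 : ℝ)) := by
  induction d with
  | zero => exact ⟨fun _ => by norm_num, fun _ _ => rfl⟩
  | succ d ih => exact ⟨fun _ => by norm_num, fun _ => by simpa using ih⟩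

lemma succ {d : ℕ} {G : (ι → Bool) → ℝ} (hG : PhaseDeg d G) : PhaseDeg (d + 1) G := by
  induction d generalizing G with
  | zero =>
    refine ⟨hG.1, fun y => ⟨fun x => ?_, fun x z => ?_⟩⟩
    · linear_combination G (xo x y) * G (xo x y) * hG.1 x + hG.1 (xo x y)
    · simp only [hG.2 x z, hG.2 (xo x y) (xo z y)]
  | succ d ih => exact ⟨hG.1, fun y => ih (hG.2 y)⟩

lemma mono {d e : ℕ} (h : d ≤ e) {G : (ι → Bool) → ℝ} (hG : PhaseDeg d G) : PhaseDeg e G := by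
  induction h with
  | refl => exact hG
  | step _ ih => exact ih.succ

lemma sg_coord (b : ι) (d : ℕ) : PhaseDeg (d + 1) (fun x : ι → Bool => sg (x b)) := by
  refine mono (d := 1) (by omega) ⟨fun x => sg_mul_self _, fun y => ⟨fun x => ?_, fun x z => ?_⟩⟩
  · simp only [xo, sg_xor]
    linear_combination (sg (x b) ^ 2 + 1) * sg (y b) ^ 2 * sg_mul_self (x b) + sg_mul_self (y b)
  · simp only [xo, sg_xor]
    linear_combination sg (y b) * sg_mul_self (x b) - sg (y b) * sg_mul_self (z b)

lemma comp_mix {d : ℕ} {G : (ι → Bool) → ℝ} (hG : PhaseDeg d G) (Q : Finset ι) (z : ι → Bool) :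
    PhaseDeg d (fun y => G (mix Q z y)) := by
  induction d generalizing G with
  | zero => exact ⟨fun x => hG.1 _, fun x y => hG.2 _ _⟩
  | succ d ih =>
    refine ⟨fun x => hG.1 _, fun y => ?_⟩
    have := ih (hG.2 (mix Q (fun _ => false) y))
    convert this using 4 with x
    funext j
    simp only [mix, xo]
    split_ifs <;> simp

lemma ite_coord {d : ℕ} {E : (ι → Bool) → ℝ} (hE : PhaseDeg d E) (j : ι) :
    PhaseDeg (d + 1) (fun x => if x j then E x else 1) := by
  induction d generalizing E with
  | zero =>
    refine ⟨fun x => ?_, fun y => ⟨fun x => ?_, fun x z => ?_⟩⟩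
    · dsimp only; split_ifs <;> simp [hE.1]
    · have key (b : Bool) (u : ℝ) (hu : u * u = 1) :
          (if b then u else 1) * (if b then u else 1) = 1 := by cases b <;> simp [hu]
      dsimp only
      rw [mul_mul_mul_comm, key _ _ (hE.1 _), key _ _ (hE.1 _), one_mul]
    · have h1 := hE.2 x z
      have h2 := hE.2 (xo x y) z
      have h3 := hE.2 (xo z y) z
      simp only [h1, h2, h3, xo_apply]
      have := hE.1 z
      cases x j <;> cases y j <;> cases z j <;> simp [this]
  | succ d ih =>
    refine ⟨fun x => ?_, fun y => ?_⟩
    · dsimp only; split_ifs <;> simp [hE.1]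
    · have hD := ih (hE.2 y)
      cases hy : y j
      · convert hD using 2 with x
        simp only [xo_apply, hy]
        cases x j <;> simp
      · have hs : PhaseDeg (d + 1) (fun x => E (xo x y)) := by
          have := hE.mul ((hE.2 y).succ)
          convert this using 2 with x
          linear_combination - E (xo x y) * hE.1 x
        convert hs.mul hD using 2 with x
        simp only [xo_apply, hy]
        have := hE.1 (xo x y)
        cases x j <;> simp
        linear_combination - E x * this
        
lemma of_dep {d : ℕ} (T : Finset ι) (hT : T.card ≤ d) (F : (ι → Bool) → ℝ)
    (hF : ∀ x, F x * F x = 1) (hdep : ∀ x y : ι → Bool, (∀ j ∈ T, x j = y j) → F x = F y) :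
    PhaseDeg d F := by
  refine mono hT ?_
  clear hT
  induction T using Finset.induction_on generalizing F with
  | empty => exact ⟨hF, fun x y => hdep x y (by simp)⟩
  | insert j T hj ih =>
    rw [Finset.card_insert_of_notMem hj]
    have h (b : Bool) : PhaseDeg T.card (fun x => F (Function.update x j b)) := by
      refine ih _ (fun x => hF _) fun x y hxy => hdep _ _ fun i hi => ?_
      by_cases hij : i = j
      · subst hij; simp
      · simp [hij, hxy i ((Finset.mem_insert.1 hi).resolve_left hij)]
    convert (h false).succ.mul (((h false).mul (h true)).ite_coord j) using 2 with x
    cases hx : x j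
    · simp [← hx]
    · have := hF (Function.update x j false)
      simp only [if_true]
      rw [← mul_assoc, this, one_mul, ← hx, Function.update_eq_self]

lemma prod {d : ℕ} {κ : Type} (s : Finset κ) (G : κ → (ι → Bool) → ℝ)
    (hG : ∀ i ∈ s, PhaseDeg d (G i)) : PhaseDeg d (fun x => ∏ i ∈ s, G i x) := by
  classical
  induction s using Finset.induction_on with
  | empty => simpa using one d
  | insert i s hi ih =>
    simp_rw [Finset.prod_insert hi]
    exact (hG i (by simp)).mul (ih fun j hj => hG j (by simp [hj]))

end PhaseDeg

end Phase

section LevelOne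

set_option linter.unusedSectionVars false

variable {ι : Type} [Fintype ι] [DecidableEq ι]

lemma expect_flip (F : (ι → Bool) → ℝ) (b : ι) :
    𝔼 x, F (Function.update x b (!(x b))) = 𝔼 x, F x := by
  refine Fintype.expect_equiv ⟨fun x => Function.update x b (!(x b)),
    fun x => Function.update x b (!(x b)), fun x => ?_, fun x => ?_⟩ _ _ fun _ => rfl <;>
  simp

lemma expect_sg_mul_eq_zero (H : (ι → Bool) → ℝ) (b : ι)
    (hH : ∀ x : ι → Bool, H (Function.update x b (!(x b))) = H x) : 𝔼 x, sg (x b) * H x = 0 := by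
  have := expect_flip (fun x => sg (x b) * H x) b
  simp only [Function.update_self, hH, sg_not, neg_mul, Finset.expect_neg_distrib] at this
  linarith

lemma expect_sg (b : ι) : 𝔼 x : ι → Bool, sg (x b) = 0 := by
  simpa using expect_sg_mul_eq_zero (fun _ => 1) b (by simp)

lemma expect_sg_mul_sg (b c : ι) :
    𝔼 x : ι → Bool, sg (x b) * sg (x c) = if b = c then 1 else 0 := by
  split_ifs with h
  · subst h; simp [sg_mul_self]
  · exact expect_sg_mul_eq_zero (fun x => sg (x c)) b fun x => by simp [Ne.symm h]

/-- The linear form with coefficients `s` in the signs of the input bits. -/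
def linForm (s : ι → SignType) (x : ι → Bool) : ℝ := ∑ a, (s a : ℝ) * sg (x a)

/-- The correlation of `G` with a product of linear forms. -/
def multiCorr {κ : Type} [Fintype κ] (G : (ι → Bool) → ℝ) (s : κ → ι → SignType) : ℝ :=
  𝔼 x, G x * ∏ i, linForm (s i) x

/-- The linear forms have pairwise disjoint supports. -/
def DisjSupp {κ : Type} (s : κ → ι → SignType) : Prop :=
  ∀ i j, i ≠ j → ∀ a, s i a = 0 ∨ s j a = 0

lemma multiCorr_update {κ : Type} [Fintype κ] [DecidableEq κ] (G : (ι → Bool) → ℝ)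
    (s : κ → ι → SignType) (l : κ) (v : ι → SignType) :
    multiCorr G (Function.update s l v) =
      ∑ b, (v b : ℝ) * multiCorr (fun x => G x * sg (x b)) (fun i : {i // i ≠ l} => s i) := by
  unfold multiCorr
  simp_rw [Finset.mul_expect, ← Finset.expect_sum_comm]
  refine Finset.expect_congr rfl fun x _ => ?_
  rw [Fintype.prod_eq_mul_prod_subtype_ne _ l]
  have : ∀ i : {i // i ≠ l}, linForm (Function.update s l v i) x = linForm (s i) x := fun i => by
    rw [Function.update_of_ne i.2]
  simp only [this, Function.update_self]
  rw [linForm, Finset.sum_mul, Finset.mul_sum]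
  refine Finset.sum_congr rfl fun b _ => ?_
  ring

lemma DisjSupp.update {κ : Type} [DecidableEq κ] {s : κ → ι → SignType} (hs : DisjSupp s) (l : κ)
    (v : ι → SignType) (hv : ∀ a, s l a = 0 → v a = 0) : DisjSupp (Function.update s l v) := by
  intro i j hij a
  by_cases hi : i = l
  · subst hi
    rw [Function.update_self, Function.update_of_ne (Ne.symm hij)]
    exact (hs i j hij a).imp_left (hv a)
  · rw [Function.update_of_ne hi]
    by_cases hj : j = l
    · subst hj
      rw [Function.update_self]
      exact (hs i j hij a).imp_right (hv a)
    · rw [Function.update_of_ne hj]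
      exact hs i j hij a

lemma exists_split (α β : ι → ℝ) :
    ∃ A : Finset ι, ((∑ b, α b) * ∑ b, β b) - ∑ b, α b * β b ≤
      4 * ((∑ b ∈ A, α b) * ∑ b ∈ Aᶜ, β b) := by
  have key : 𝔼 x : ι → Bool, (∑ b, α b * ((1 + sg (x b)) / 2)) * ∑ b, β b * ((1 - sg (x b)) / 2)
      = (((∑ b, α b) * ∑ b, β b) - ∑ b, α b * β b) / 4 := by
    have h1 : ∀ x : ι → Bool,
        (∑ b, α b * ((1 + sg (x b)) / 2)) * ∑ b, β b * ((1 - sg (x b)) / 2) =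
        ∑ b, ∑ c, α b * β c / 4 * (1 + sg (x b) - sg (x c) - sg (x b) * sg (x c)) := fun x => by
      rw [Finset.sum_mul_sum]
      refine Finset.sum_congr rfl fun b _ => Finset.sum_congr rfl fun c _ => by ring
    simp_rw [h1, Finset.expect_sum_comm, ← Finset.mul_expect, Finset.expect_sub_distrib,
      Finset.expect_add_distrib, expect_sg, expect_sg_mul_sg]
    simp only [Fintype.expect_const, add_zero, sub_zero, mul_sub, mul_one, mul_ite, mul_zero,
      Finset.sum_sub_distrib, Finset.sum_ite_eq, Finset.mem_univ, if_true]
    rw [Finset.sum_mul_sum, sub_div]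
    simp_rw [Finset.sum_div]
  obtain ⟨x, -, hx⟩ := Finset.exists_le_of_le_expect (Finset.univ_nonempty) key.ge
  refine ⟨Finset.univ.filter fun b => x b = false, ?_⟩
  have e1 : ∑ b, α b * ((1 + sg (x b)) / 2) = ∑ b ∈ Finset.univ.filter fun b => x b = false, α b := by
    rw [Finset.sum_filter]
    refine Finset.sum_congr rfl fun b _ => ?_
    cases h : x b <;> simp [sg]
  have e2 : ∑ b, β b * ((1 - sg (x b)) / 2) =
      ∑ b ∈ (Finset.univ.filter fun b => x b = false)ᶜ, β b := by
    rw [Finset.compl_filter, Finset.sum_filter]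
    refine Finset.sum_congr rfl fun b _ => ?_
    cases h : x b <;> norm_num [sg]
  rw [e1, e2] at hx
  linarith

/-- The restriction of a sign vector to a set of coordinates. -/
def restr (A : Finset ι) (v : ι → SignType) : ι → SignType := fun a => if a ∈ A then v a else 0

lemma sum_restr (A : Finset ι) (v : ι → SignType) (c : ι → ℝ) :
    ∑ b, (restr A v b : ℝ) * c b = ∑ b ∈ A, (v b : ℝ) * c b := by
  rw [← Finset.sum_filter_add_sum_filter_not Finset.univ (· ∈ A)]
  simp only [restr]
  rw [Finset.sum_congr (g := fun b => (v b : ℝ) * c b) (by simp; rfl) (fun b hb => by simp_all),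
    Finset.sum_eq_zero (s := Finset.univ.filter (· ∉ A)) (fun b hb => by simp_all), add_zero]

lemma multiCorr_split {κ : Type} [Fintype κ] [DecidableEq κ] (G : (ι → Bool) → ℝ)
    (s s' : κ → ι → SignType) (l : κ) (hl : s l = s' l) (hs : DisjSupp s) (p P : ℝ)
    (hP : ∀ v, (∀ a, s l a = 0 → v a = 0) → multiCorr G (Function.update s l v) ≤ P)
    (hp0 : 0 ≤ p)
    (hp : ∀ b, |multiCorr (fun x => G x * sg (x b)) (fun i : {i // i ≠ l} => s' i)| ≤ p) :
    ∃ A : Finset ι, multiCorr G s * multiCorr G s' ≤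
      4 * (multiCorr G (Function.update s l (restr A (s l))) *
        multiCorr G (Function.update s' l (restr Aᶜ (s' l)))) + p * P := by
  set c := fun b => multiCorr (fun x => G x * sg (x b)) (fun i : {i // i ≠ l} => s i) with hc
  set c' := fun b => multiCorr (fun x => G x * sg (x b)) (fun i : {i // i ≠ l} => s' i) with hc'
  obtain ⟨A, hA⟩ := exists_split (fun b => (s l b : ℝ) * c b) (fun b => (s' l b : ℝ) * c' b)
  have es : multiCorr G s = ∑ b, (s l b : ℝ) * c b := by
    rw [hc, ← multiCorr_update, Function.update_eq_self]
  have es' : multiCorr G s' = ∑ b, (s' l b : ℝ) * c' b := by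
    rw [hc', ← multiCorr_update, Function.update_eq_self]
  refine ⟨A, ?_⟩
  rw [multiCorr_update, multiCorr_update, sum_restr, sum_restr, es, es']
  have habs : ∑ b, |(s l b : ℝ) * c b| ≤ P := by
    refine le_trans (le_of_eq ?_) (hP (fun b => s l b * SignType.sign ((s l b : ℝ) * c b)) ?_)
    · rw [multiCorr_update]
      refine Finset.sum_congr rfl fun b _ => ?_
      rw [SignType.coe_mul, ← sign_mul_self]
      ring
    · intro a ha; simp [ha]
  have : ∑ b, (s l b : ℝ) * c b * ((s' l b : ℝ) * c' b) ≤ p * P := by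
    refine le_trans (Finset.sum_le_sum (g := fun b => p * |(s l b : ℝ) * c b|) fun b _ => ?_) ?_
    · refine (le_abs_self _).trans ?_
      rw [abs_mul, mul_comm]
      refine mul_le_mul_of_nonneg_right ?_ (abs_nonneg _)
      rw [abs_mul]
      refine le_trans ?_ (hp b)
      have h1 : |(s' l b : ℝ)| ≤ 1 := by rcases s' l b with _ | _ | _ <;> simp
      exact (mul_le_mul_of_nonneg_right h1 (abs_nonneg _)).trans (by rw [one_mul])
    · rw [← Finset.mul_sum]
      exact mul_le_mul_of_nonneg_left habs hp0
  linarith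

end LevelOne

section LevelOneBound

set_option linter.unusedSectionVars false

variable {ι : Type} [Fintype ι] [DecidableEq ι]

lemma multiCorr_sq_le {κ : Type} [Fintype κ] [DecidableEq κ] (G : (ι → Bool) → ℝ)
    (s : κ → ι → SignType) (hs : DisjSupp s) (p P : ℝ) (hp0 : 0 ≤ p)
    (hP : ∀ s' : κ → ι → SignType, DisjSupp s' → |multiCorr G s'| ≤ P)
    (hp : ∀ s' : κ → ι → SignType, DisjSupp s' → ∀ (b : ι) (l : κ),
      |multiCorr (fun x => G x * sg (x b)) (fun i : {i // i ≠ l} => s' i)| ≤ p)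
    (J : Finset κ) :
    ∃ A : κ → Finset ι, multiCorr G s ^ 2 ≤
      4 ^ J.card * (multiCorr G (fun i => if i ∈ J then restr (A i) (s i) else s i) *
        multiCorr G (fun i => if i ∈ J then restr (A i)ᶜ (s i) else s i)) +
      4 ^ J.card * J.card * (p * P) := by
  have hP0 : 0 ≤ P := (abs_nonneg _).trans (hP s hs)
  have hdisj (A : κ → Finset ι) (J : Finset κ) :
      DisjSupp (fun i => if i ∈ J then restr (A i) (s i) else s i) := by
    intro i j hij a
    rcases hs i j hij a with h | h
    · left; simp only [restr]; split_ifs <;> simp [h, restr]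
    · right; simp only [restr]; split_ifs <;> simp [h, restr]
  induction J using Finset.induction_on with
  | empty => exact ⟨fun _ => ∅, by simp [sq]⟩
  | insert l J hl ih =>
    obtain ⟨A, hA⟩ := ih
    have hd1 := hdisj A J
    have hd2 := hdisj (fun i => (A i)ᶜ) J
    obtain ⟨A₀, hA₀⟩ := multiCorr_split G (fun i => if i ∈ J then restr (A i) (s i) else s i)
      (fun i => if i ∈ J then restr (A i)ᶜ (s i) else s i) l (by simp [hl]) hd1 p P
      (fun v hv => (le_abs_self _).trans (hP _ (hd1.update l v hv))) hp0 (fun b => hp _ hd2 b l)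
    refine ⟨Function.update A l A₀, ?_⟩
    have e1 : Function.update (fun i => if i ∈ J then restr (A i) (s i) else s i) l
        (restr A₀ (if l ∈ J then restr (A l) (s l) else s l)) =
        fun i => if i ∈ insert l J then restr (Function.update A l A₀ i) (s i) else s i := by
      funext i
      by_cases hi : i = l
      · subst hi; simp [hl]
      · simp [hi]
    have e2 : Function.update (fun i => if i ∈ J then restr (A i)ᶜ (s i) else s i) l
        (restr A₀ᶜ (if l ∈ J then restr (A l)ᶜ (s l) else s l)) =
        fun i => if i ∈ insert l J then restr (Function.update A l A₀ i)ᶜ (s i) else s i := by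
      funext i
      by_cases hi : i = l
      · subst hi; simp [hl]
      · simp [hi]
    rw [e1, e2] at hA₀
    rw [Finset.card_insert_of_notMem hl]
    have arith (a X Y c j r : ℝ) (h1 : a ≤ c * X + c * j * r) (h2 : X ≤ 4 * Y + r) (hc : 0 ≤ c)
        (hj : 0 ≤ j) (hr : 0 ≤ r) : a ≤ c * 4 * Y + c * 4 * (j + 1) * r := by
      have h3 := mul_le_mul_of_nonneg_left h2 hc
      have h5 := mul_nonneg hc hr
      have h6 := mul_nonneg (mul_nonneg hc hj) hr
      linarith
    rw [Nat.cast_add, Nat.cast_one, pow_succ]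
    exact arith _ _ _ _ _ _ hA hA₀ (pow_nonneg (by norm_num) _) (Nat.cast_nonneg _) (mul_nonneg hp0 hP0)

/-- The sign of a bit as an element of `SignType`. -/
def sgT (b : Bool) : SignType := if b then -1 else 1

lemma coe_sgT (b : Bool) : ((sgT b : SignType) : ℝ) = sg b := by cases b <;> simp [sgT, sg]

lemma multiCorr_mul {κ : Type} [Fintype κ] (G : (ι → Bool) → ℝ) (s s' : κ → ι → SignType) :
    multiCorr G s * multiCorr G s' = 𝔼 y : ι → Bool,
      multiCorr (fun x => G x * G (xo x y)) (Sum.elim s (fun i a => s' i a * sgT (y a))) := by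
  unfold multiCorr
  rw [Finset.expect_comm, Finset.expect_mul]
  refine Finset.expect_congr rfl fun x _ => ?_
  rw [← expect_xo_right _ x, Finset.mul_expect]
  refine Finset.expect_congr rfl fun y _ => ?_
  rw [Fintype.prod_sum_type]
  have : ∀ i, linForm (Sum.elim s (fun i a => s' i a * sgT (y a)) (Sum.inr i)) x =
      linForm (s' i) (xo x y) := fun i => by
    refine Finset.sum_congr rfl fun a _ => ?_
    rw [xo_apply, sg_xor, Sum.elim_inr, SignType.coe_mul, coe_sgT]
    ring
  simp only [this, Sum.elim_inl]
  ring

lemma PhaseDeg.exists_multiCorr_le (d k : ℕ) : ∃ C : ℝ, 0 ≤ C ∧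
    ∀ (κ : Type) [Fintype κ] [DecidableEq κ], Fintype.card κ = k →
    ∀ (ι : Type) [Fintype ι] [DecidableEq ι] (G : (ι → Bool) → ℝ), PhaseDeg d G →
    ∀ s : κ → ι → SignType, DisjSupp s → |multiCorr G s| ≤ C := by
  have h0 (d : ℕ) (κ : Type) [Fintype κ] [DecidableEq κ] (hκ : Fintype.card κ = 0)
      (ι : Type) [Fintype ι] [DecidableEq ι] (G : (ι → Bool) → ℝ) (hG : PhaseDeg d G)
      (s : κ → ι → SignType) : |multiCorr G s| ≤ 1 := by
    have := Fintype.card_eq_zero_iff.1 hκ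
    refine (Finset.abs_expect_le _ _).trans (Finset.expect_le Finset.univ_nonempty fun x _ => ?_)
    simp [hG.abs_eq]
  induction d generalizing k with
  | zero =>
    refine ⟨1, zero_le_one, fun κ _ _ hκ ι _ _ G hG s hs => ?_⟩
    rcases isEmpty_or_nonempty κ with h | ⟨⟨l⟩⟩
    · exact h0 0 κ (Fintype.card_eq_zero_iff.2 h) ι G hG s
    · suffices h : multiCorr G s = 0 by simp [h]
      rw [← Function.update_eq_self l s, multiCorr_update]
      refine Finset.sum_eq_zero fun b _ => ?_
      by_cases hb : s l b = 0
      · simp [hb]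
      refine mul_eq_zero_of_right _ ?_
      unfold multiCorr
      simp_rw [mul_comm (G _), mul_assoc]
      refine expect_sg_mul_eq_zero (fun x => G x * ∏ i : {i // i ≠ l}, linForm (s i) x) b
        fun x => ?_
      rw [hG.2 (Function.update x b (!(x b))) x]
      congr 1
      refine Finset.prod_congr rfl fun i _ => Finset.sum_congr rfl fun a _ => ?_
      by_cases ha : a = b
      · subst ha
        simp [(hs i l i.2 a).resolve_right hb]
      · simp [ha]
  | succ d ihd =>
    induction k with
    | zero => exact ⟨1, zero_le_one, fun κ _ _ hκ ι _ _ G hG s _ => h0 _ κ hκ ι G hG s⟩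
    | succ k ihk =>
      obtain ⟨p, hp0, hp⟩ := ihk
      obtain ⟨q, hq0, hq⟩ := ihd (2 * (k + 1))
      set a : ℝ := 4 ^ (k + 1) * q
      set b : ℝ := 4 ^ (k + 1) * (k + 1 : ℕ) * p
      have ha : 0 ≤ a := by positivity
      have hb : 0 ≤ b := by positivity
      refine ⟨a + b + 1, by positivity, fun κ _ _ hκ ι _ _ G hG s hs => ?_⟩
      classical
      obtain ⟨s₀, hs₀⟩ := Finite.exists_max
        (fun s : κ → ι → SignType => if DisjSupp s then |multiCorr G s| else 0)
      set P := if DisjSupp s₀ then |multiCorr G s₀| else 0 with hPdef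
      have hP (s' : κ → ι → SignType) (h : DisjSupp s') : |multiCorr G s'| ≤ P := by
        have := hs₀ s'
        simpa [h] using this
      refine (hP s hs).trans ?_
      by_cases hd : DisjSupp s₀
      swap
      · rw [hPdef, if_neg hd]; positivity
      have hPe : P = |multiCorr G s₀| := if_pos hd
      obtain ⟨A, hA⟩ := multiCorr_sq_le G s₀ hd p P hp0 hP (fun s' hs' b l => by
        refine hp {i // i ≠ l} (by simp [hκ]) ι _ (hG.mul (PhaseDeg.sg_coord b d)) _ ?_
        exact fun i j hij a => hs' i j (fun h => hij (Subtype.ext h)) a) Finset.univ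
      rw [multiCorr_mul] at hA
      have hle : 𝔼 y : ι → Bool, multiCorr (fun x => G x * G (xo x y))
          (Sum.elim (fun i => if i ∈ Finset.univ then restr (A i) (s₀ i) else s₀ i)
          (fun i a => (if i ∈ Finset.univ then restr (A i)ᶜ (s₀ i) else s₀ i) a * sgT (y a))) ≤ q := by
        refine Finset.expect_le Finset.univ_nonempty fun y _ => (le_abs_self _).trans
          (hq (κ ⊕ κ) (by simp [hκ]; ring) ι _ (hG.2 y) _ ?_)
        have key : ∀ i j, ∀ c, restr (A i) (s₀ i) c = 0 ∨ restr (A j)ᶜ (s₀ j) c = 0 := by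
          intro i j c
          by_cases hij : i = j
          · subst hij
            by_cases hc : c ∈ A i <;> simp [restr, hc]
          · rcases hd i j hij c with h | h <;> simp [restr, h]
        have hr : ∀ i (B : Finset ι) c, s₀ i c = 0 → restr B (s₀ i) c = 0 := by
          intro i B c h; simp [restr, h]
        rintro (i | i) (j | j) hij c
        · have hij' : i ≠ j := fun h => hij (by rw [h])
          simp only [Finset.mem_univ, if_true, Sum.elim_inl]
          exact (hd i j hij' c).imp (hr _ _ _) (hr _ _ _)
        · simp only [Finset.mem_univ, if_true, Sum.elim_inl, Sum.elim_inr]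
          exact (key i j c).imp_right fun h => by rw [h, zero_mul]
        · simp only [Finset.mem_univ, if_true, Sum.elim_inl, Sum.elim_inr]
          exact (key j i c).symm.imp_left fun h => by rw [h, zero_mul]
        · have hij' : i ≠ j := fun h => hij (by rw [h])
          simp only [Finset.mem_univ, if_true, Sum.elim_inr]
          exact (hd i j hij' c).imp (fun h => by rw [hr _ _ _ h, zero_mul])
            (fun h => by rw [hr _ _ _ h, zero_mul])
      have hfin : P ^ 2 ≤ a + b * P := by
        rw [hPe, sq_abs, ← hPe]
        refine hA.trans ?_
        rw [Finset.card_univ, hκ]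
        have := mul_le_mul_of_nonneg_left hle (show (0 : ℝ) ≤ 4 ^ (k + 1) by positivity)
        simp only [a, b]
        linarith
      by_contra! hcon
      nlinarith

/-- The level-one Fourier weight in `ℓ¹` of a phase of bounded degree is bounded. -/
lemma PhaseDeg.exists_sum_abs_le (d : ℕ) : ∃ C : ℝ, 0 ≤ C ∧
    ∀ (ι : Type) [Fintype ι] [DecidableEq ι] (G : (ι → Bool) → ℝ), PhaseDeg d G →
    ∑ j, |𝔼 y : ι → Bool, sg (y j) * G y| ≤ C := by
  obtain ⟨C, hC, h⟩ := PhaseDeg.exists_multiCorr_le d 1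
  refine ⟨C, hC, fun ι _ _ G hG => ?_⟩
  refine le_trans (le_of_eq ?_) ((le_abs_self _).trans (h Unit (by simp) ι G hG
    (fun _ j => SignType.sign (𝔼 y : ι → Bool, sg (y j) * G y)) (fun i j hij => (hij rfl).elim)))
  unfold multiCorr linForm
  simp_rw [Fintype.prod_unique, Finset.mul_sum, Finset.expect_sum_comm]
  refine Finset.sum_congr rfl fun j _ => ?_
  rw [← sign_mul_self, Finset.mul_expect]
  refine Finset.expect_congr rfl fun y _ => ?_
  ring

end LevelOneBound

section Covariance

set_option linter.unusedSectionVars false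

variable {ι : Type} [Fintype ι] [DecidableEq ι]

/-- The correlation of `G` and `h` at inputs that share the bits off `Q` and are otherwise
independent. -/
def mixCorr (G h : (ι → Bool) → ℝ) (Q : Finset ι) : ℝ := 𝔼 x, 𝔼 y, G x * h (mix Q x y)

lemma mix_empty (x y : ι → Bool) : mix ∅ x y = x := by funext j; simp [mix]

lemma mix_univ (x y : ι → Bool) : mix Finset.univ x y = y := by funext j; simp [mix]

lemma mixCorr_univ (G h : (ι → Bool) → ℝ) :
    mixCorr G h Finset.univ = (𝔼 x, G x) * 𝔼 x, h x := by
  simp [mixCorr, mix_univ, Finset.expect_mul_expect]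

lemma expect_mix (Q : Finset ι) (F : (ι → Bool) → ℝ) : 𝔼 x, 𝔼 y, F (mix Q x y) = 𝔼 x, F x := by
  have h1 : 𝔼 p : (ι → Bool) × (ι → Bool), F (mix Q p.1 p.2) =
      𝔼 p : (ι → Bool) × (ι → Bool), F p.1 :=
    Fintype.expect_equiv ⟨fun p => (mix Q p.1 p.2, mix Q p.2 p.1),
      fun p => (mix Q p.1 p.2, mix Q p.2 p.1),
      fun p => by ext j <;> simp only [mix] <;> split_ifs <;> rfl,
      fun p => by ext j <;> simp only [mix] <;> split_ifs <;> rfl⟩ _ _ fun _ => rfl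
  rw [← Finset.univ_product_univ, Finset.expect_product, Finset.expect_product] at h1
  simpa using h1

lemma expect_update (F : (ι → Bool) → ℝ) (j : ι) (b : Bool) :
    𝔼 y, F (Function.update y j b) = 𝔼 y, (1 + sg b * sg (y j)) * F y := by
  have h1 : ∀ y : ι → Bool, F (Function.update y j b) =
      ((1 + sg b * sg (y j)) * F y + (1 - sg b * sg (y j)) * F (Function.update y j (!(y j)))) / 2 :=
      fun y => by
    by_cases h : y j = b
    · subst h; simp [sg_mul_self]; ring
    · have hb : b = !(y j) := by cases b <;> cases hy : y j <;> simp_all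
      rw [hb, sg_not]
      linear_combination (F y - F (Function.update y j (!(y j)))) / 2 * sg_mul_self (y j)
  have h2 := expect_flip (fun y => (1 + sg b * sg (y j)) * F y) j
  simp only [Function.update_self, sg_not, mul_neg, ← sub_eq_add_neg] at h2
  simp_rw [h1, ← Finset.expect_div, Finset.expect_add_distrib, h2]
  ring

lemma mix_mix (Q : Finset ι) (x y z : ι → Bool) : mix Q (mix Q x y) z = mix Q x z := by
  funext j; simp only [mix]; split_ifs <;> rfl

lemma mix_apply {Q : Finset ι} {j : ι} (hj : j ∈ Q) (x y : ι → Bool) : mix Q x y j = y j := by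
  simp [mix, hj]

lemma mix_update {Q : Finset ι} {j : ι} (hj : j ∈ Q) (x y : ι → Bool) (b : Bool) :
    mix Q x (Function.update y j b) = Function.update (mix Q x y) j b := by
  funext i
  by_cases hi : i = j
  · subst hi; simp [mix, hj]
  · simp [mix, hi]

lemma mix_erase {Q : Finset ι} {j : ι} (hj : j ∈ Q) (x y : ι → Bool) :
    mix (Q.erase j) x y = mix Q x (Function.update y j (x j)) := by
  funext i
  by_cases hi : i = j
  · subst hi; simp [mix, hj]
  · simp [mix, hi]

lemma mixCorr_erase_sub (G h : (ι → Bool) → ℝ) {Q : Finset ι} {j : ι} (hj : j ∈ Q) :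
    mixCorr G h (Q.erase j) - mixCorr G h Q =
      𝔼 z, (𝔼 u : ι → Bool, sg (u j) * G (mix Q z u)) *
        𝔼 y : ι → Bool, sg (y j) * h (mix Q z y) := by
  unfold mixCorr
  have h1 : ∀ x, 𝔼 y, G x * h (mix (Q.erase j) x y) =
      𝔼 y : ι → Bool, G x * h (mix Q x y) +
        𝔼 y : ι → Bool, sg (x j) * sg (y j) * (G x * h (mix Q x y)) := fun x => by
    simp_rw [mix_erase hj]
    rw [expect_update (fun y => G x * h (mix Q x y)), ← Finset.expect_add_distrib]
    refine Finset.expect_congr rfl fun y _ => by ring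
  simp_rw [h1, Finset.expect_add_distrib, add_sub_cancel_left]
  rw [← expect_mix Q]
  refine Finset.expect_congr rfl fun z _ => ?_
  rw [Finset.expect_mul_expect]
  refine Finset.expect_congr rfl fun u _ => Finset.expect_congr rfl fun y _ => ?_
  rw [mix_mix, mix_apply hj]
  ring

lemma abs_expect_sg_mul_le (h M : (ι → Bool) → ℝ)
    (hM : ∀ x j, |h x - h (Function.update x j (!(x j)))| ≤ M x) {Q : Finset ι} {j : ι}
    (hj : j ∈ Q) (z : ι → Bool) :
    |𝔼 y : ι → Bool, sg (y j) * h (mix Q z y)| ≤ (𝔼 y, M (mix Q z y)) / 2 := by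
  have h1 := expect_flip (fun y => sg (y j) * h (mix Q z y)) j
  have h2 : 𝔼 y : ι → Bool, sg (y j) * h (mix Q z y) = (𝔼 y : ι → Bool, sg (y j) *
      (h (mix Q z y) - h (Function.update (mix Q z y) j (!(mix Q z y j))))) / 2 := by
    simp only [mul_sub, Finset.expect_sub_distrib]
    simp only [Function.update_self, sg_not, neg_mul, Finset.expect_neg_distrib,
      mix_update hj] at h1
    simp only [mix_apply hj]
    linarith
  rw [h2, abs_div, abs_two]
  refine div_le_div_of_nonneg_right ?_ zero_le_two
  refine (Finset.abs_expect_le _ _).trans (Finset.expect_le_expect fun y _ => ?_)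
  rw [abs_mul, abs_sg, one_mul]
  exact hM _ _

lemma sum_mixCorr_erase_le {G h M : (ι → Bool) → ℝ} {C : ℝ}
    (hG : ∀ Q z, ∑ j, |𝔼 u : ι → Bool, sg (u j) * G (mix Q z u)| ≤ C)
    (hM : ∀ x j, |h x - h (Function.update x j (!(x j)))| ≤ M x) (hM0 : ∀ x, 0 ≤ M x)
    (Q : Finset ι) :
    ∑ j ∈ Q, |mixCorr G h (Q.erase j) - mixCorr G h Q| ≤ C * (𝔼 x, M x) / 2 := by
  have step : ∀ j ∈ Q, |mixCorr G h (Q.erase j) - mixCorr G h Q| ≤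
      𝔼 z, |𝔼 u : ι → Bool, sg (u j) * G (mix Q z u)| * ((𝔼 y, M (mix Q z y)) / 2) :=
      fun j hj => by
    rw [mixCorr_erase_sub G h hj]
    refine (Finset.abs_expect_le _ _).trans (Finset.expect_le_expect fun z _ => ?_)
    rw [abs_mul]
    exact mul_le_mul_of_nonneg_left (abs_expect_sg_mul_le h M hM hj z) (abs_nonneg _)
  refine (Finset.sum_le_sum step).trans ?_
  rw [← Finset.expect_sum_comm, mul_div_assoc, ← expect_mix Q M, Finset.expect_div,
    Finset.mul_expect]
  refine Finset.expect_le_expect fun z _ => ?_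
  rw [← Finset.sum_mul]
  refine mul_le_mul_of_nonneg_right ?_
    (div_nonneg (Finset.expect_nonneg fun _ _ => hM0 _) zero_le_two)
  exact (Finset.sum_le_sum_of_subset_of_nonneg (Finset.subset_univ _)
    fun _ _ _ => abs_nonneg _).trans (hG Q z)

lemma exists_greedy (φ : Finset ι → ℝ) (c : ℝ)
    (hφ : ∀ Q, ∑ j ∈ Q, |φ (Q.erase j) - φ Q| ≤ c) (w : ι → ℝ) (hw : ∀ j, 0 ≤ w j) (b : ℝ)
    (hb : 0 ≤ b) (k : ℕ) (hk : k ≤ Fintype.card ι) :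
    ∃ Q : Finset ι, Q.card = k ∧ |φ Q - φ Finset.univ| + b * ((∑ j ∈ Q, w j) / k) ≤
      c * (∑ i ∈ Finset.Ioc k (Fintype.card ι), (i : ℝ)⁻¹) +
        b * ((∑ j, w j) / Fintype.card ι) := by
  induction hk using Nat.decreasingInduction with
  | self => exact ⟨Finset.univ, by simp⟩
  | of_succ k hk ih =>
    obtain ⟨Q, hQ, hle⟩ := ih
    have hQne : Q.Nonempty := Finset.card_pos.1 (by omega)
    obtain ⟨j, hj, hjle⟩ : ∃ j ∈ Q, |φ (Q.erase j) - φ Finset.univ| +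
        b * ((∑ i ∈ Q.erase j, w i) / k) ≤ |φ Q - φ Finset.univ| + c / (k + 1 : ℕ) +
        b * ((∑ i ∈ Q, w i) / (k + 1 : ℕ)) := by
      refine Finset.exists_le_of_sum_le hQne ?_
      have hk0 : ((k + 1 : ℕ) : ℝ) ≠ 0 := by positivity
      rw [Finset.sum_const, hQ, nsmul_eq_mul, mul_add, mul_add, mul_div_cancel₀ _ hk0,
        Finset.sum_add_distrib]
      refine add_le_add ?_ ?_
      · calc ∑ j ∈ Q, |φ (Q.erase j) - φ Finset.univ|
            ≤ ∑ j ∈ Q, (|φ Q - φ Finset.univ| + |φ (Q.erase j) - φ Q|) := by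
              refine Finset.sum_le_sum fun j _ => ?_
              rw [add_comm]
              exact abs_sub_le _ _ _
          _ ≤ _ := by
              rw [Finset.sum_add_distrib, Finset.sum_const, hQ, nsmul_eq_mul]
              exact add_le_add_right (hφ Q) _
      · rw [← Finset.mul_sum, ← Finset.sum_div, mul_left_comm, mul_div_cancel₀ _ hk0]
        refine mul_le_mul_of_nonneg_left ?_ hb
        have h1 : ∑ j ∈ Q, ∑ i ∈ Q.erase j, w i = k * ∑ i ∈ Q, w i := by
          rw [Finset.sum_congr rfl fun j hj => Finset.sum_erase_eq_sub hj,
            Finset.sum_sub_distrib, Finset.sum_const, hQ, nsmul_eq_mul]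
          push_cast; ring
        rw [h1]
        have h0 : 0 ≤ ∑ i ∈ Q, w i := Finset.sum_nonneg fun i _ => hw i
        rcases Nat.eq_zero_or_pos k with rfl | hk
        · simpa using h0
        · rw [mul_div_cancel_left₀ _ (by positivity)]
    refine ⟨Q.erase j, by rw [Finset.card_erase_of_mem hj, hQ]; rfl, ?_⟩
    have hsplit : ∑ i ∈ Finset.Ioc k (Fintype.card ι), (i : ℝ)⁻¹ =
        ((k + 1 : ℕ) : ℝ)⁻¹ + ∑ i ∈ Finset.Ioc (k + 1) (Fintype.card ι), (i : ℝ)⁻¹ := by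
      rw [← Finset.sum_Ioc_consecutive _ (Nat.le_succ k) hk]
      simp
    rw [hsplit, mul_add, ← div_eq_mul_inv]
    linarith

lemma sum_Ioc_inv_le {k m : ℕ} (hkm : k < m) :
    ∑ i ∈ Finset.Ioc k m, (i : ℝ)⁻¹ ≤ 1 + Real.log (m / (k + 1 : ℕ)) := by
  induction m, hkm using Nat.le_induction with
  | base =>
    have : ((k + 1 : ℕ) : ℝ)⁻¹ ≤ 1 := inv_le_one_of_one_le₀ (by simp)
    simpa using this
  | succ m hm ih =>
    rw [Finset.sum_Ioc_succ_top (by omega)]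
    have hm0 : (0 : ℝ) < m := by exact_mod_cast (by omega : 0 < m)
    have h1 := Real.one_sub_inv_le_log_of_pos (x := ((m + 1 : ℕ) : ℝ) / m) (by positivity)
    have h2 : ((m + 1 : ℕ) : ℝ)⁻¹ = 1 - (((m + 1 : ℕ) : ℝ) / m)⁻¹ := by
      push_cast; field_simp; ring
    rw [Real.log_div (by positivity) (by positivity)] at h1 ih ⊢
    linarith

lemma exists_mix_le {G h M : (ι → Bool) → ℝ} {C c : ℝ}
    (hG : ∀ Q z, ∑ j, |𝔼 u : ι → Bool, sg (u j) * G (mix Q z u)| ≤ C)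
    (hM : ∀ x j, |h x - h (Function.update x j (!(x j)))| ≤ M x) (hM0 : ∀ x, 0 ≤ M x)
    (hc : C * (𝔼 x, M x) / 2 ≤ c) (hc0 : 0 < c) (w : ι → ℝ) (hw : ∀ j, 0 ≤ w j) {ρ : ℝ}
    (hρ : 0 < ρ) (hρ1 : ρ ≤ 1) :
    ∃ Q : Finset ι, ∑ j ∈ Q, w j ≤ 2 * ρ * ∑ j, w j ∧
      |mixCorr G h Q - (𝔼 x, G x) * 𝔼 x, h x| ≤ 2 * c * (1 + Real.log (1 / ρ)) := by
  set m := Fintype.card ι with hm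
  have hW0 : 0 ≤ ∑ j, w j := Finset.sum_nonneg fun j _ => hw j
  set W := ∑ j, w j with hW
  have hlog : 0 ≤ Real.log (1 / ρ) := Real.log_nonneg (by rw [le_div_iff₀ hρ]; linarith)
  set ℓ := 1 + Real.log (1 / ρ) with hℓ
  set k := ⌊ρ * m⌋₊ with hk
  have hkρ : (k : ℝ) ≤ ρ * m := Nat.floor_le (by positivity)
  have hkm : k ≤ m := by
    have : (k : ℝ) ≤ m := hkρ.trans (mul_le_of_le_one_left (by positivity) hρ1)
    exact_mod_cast this
  have hsum : ∑ i ∈ Finset.Ioc k m, (i : ℝ)⁻¹ ≤ ℓ := by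
    rcases hkm.eq_or_lt with h | h
    · rw [h, Finset.Ioc_self, Finset.sum_empty]; linarith
    · refine (sum_Ioc_inv_le h).trans (add_le_add_right (Real.log_le_log ?_ ?_) _)
      · have : (0 : ℝ) < m := by exact_mod_cast (by omega : 0 < m)
        positivity
      · rw [div_le_div_iff₀ (by positivity) hρ]
        have := (Nat.lt_floor_add_one (ρ * m)).le
        push_cast
        linarith
  obtain ⟨Q, hQk, hQ⟩ := exists_greedy (mixCorr G h) (C * (𝔼 x, M x) / 2)
    (sum_mixCorr_erase_le hG hM hM0) w hw (c * ℓ / (W / m)) (by positivity) k hkm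
  rw [mixCorr_univ, ← hm, ← hW] at hQ
  have hcs : C * (𝔼 x, M x) / 2 * ∑ i ∈ Finset.Ioc k m, (i : ℝ)⁻¹ ≤ c * ℓ :=
    mul_le_mul hc hsum (Finset.sum_nonneg fun i _ => by positivity) hc0.le
  have hw0 : 0 ≤ ∑ j ∈ Q, w j := Finset.sum_nonneg fun i _ => hw i
  have hbW : c * ℓ / (W / m) * (W / m) ≤ c * ℓ := by
    rcases eq_or_ne (W / m) 0 with h | h
    · rw [h, mul_zero]; positivity
    · rw [div_mul_cancel₀ _ h]
  refine ⟨Q, ?_, ?_⟩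
  · rcases Nat.eq_zero_or_pos k with h0 | hkpos
    · have : Q = ∅ := by rw [← Finset.card_eq_zero, hQk, h0]
      rw [this, Finset.sum_empty]; positivity
    rcases hW0.eq_or_lt with hW0 | hWpos
    · have : ∑ j ∈ Q, w j ≤ W :=
        Finset.sum_le_sum_of_subset_of_nonneg (Finset.subset_univ _) fun i _ _ => hw i
      rw [← hW0] at this ⊢
      linarith
    have hmpos : (0 : ℝ) < m := by exact_mod_cast (by omega : 0 < m)
    have h1 : c * ℓ / (W / m) * ((∑ j ∈ Q, w j) / k) ≤ 2 * (c * ℓ) := by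
      linarith [abs_nonneg (mixCorr G h Q - (𝔼 x, G x) * 𝔼 x, h x)]
    have hcl : 0 < c * ℓ := by positivity
    have h2 : (∑ j ∈ Q, w j) / k ≤ 2 * (W / m) := by
      have : c * ℓ / (W / m) * ((∑ j ∈ Q, w j) / k) =
        c * ℓ * (((∑ j ∈ Q, w j) / k) / (W / m)) := by ring
      rw [this, mul_comm 2] at h1
      have h3 := le_of_mul_le_mul_left h1 hcl
      rwa [div_le_iff₀ (by positivity)] at h3
    rw [div_le_iff₀ (by positivity)] at h2
    refine h2.trans ?_
    calc 2 * (W / m) * k ≤ 2 * (W / m) * (ρ * m) := by gcongr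
      _ = 2 * ρ * W := by field_simp
  · have : 0 ≤ c * ℓ / (W / m) * ((∑ j ∈ Q, w j) / k) := by positivity
    linarith

/-- The covariance of a phase with a function of small sensitivity, up to resampling a set of
inputs of small weight. -/
lemma abs_cov_le {G h M : (ι → Bool) → ℝ} {C c : ℝ} (hG1 : ∀ x, |G x| ≤ 1)
    (hG : ∀ Q z, ∑ j, |𝔼 u : ι → Bool, sg (u j) * G (mix Q z u)| ≤ C)
    (hM : ∀ x j, |h x - h (Function.update x j (!(x j)))| ≤ M x) (hM0 : ∀ x, 0 ≤ M x)
    (hc : C * (𝔼 x, M x) / 2 ≤ c) (hc0 : 0 < c) (w : ι → ℝ) (hw : ∀ j, 0 ≤ w j) {ρ : ℝ}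
    (hρ : 0 < ρ) (hρ1 : ρ ≤ 1) {ε : ℝ}
    (hε : ∀ Q : Finset ι, ∑ j ∈ Q, w j ≤ 2 * ρ * ∑ j, w j →
      𝔼 x, 𝔼 y, |h x - h (mix Q x y)| ≤ ε) :
    |(𝔼 x, G x * h x) - (𝔼 x, G x) * 𝔼 x, h x| ≤ 2 * c * (1 + Real.log (1 / ρ)) + ε := by
  obtain ⟨Q, hQw, hQ⟩ := exists_mix_le hG hM hM0 hc hc0 w hw hρ hρ1
  have h1 : |(𝔼 x, G x * h x) - mixCorr G h Q| ≤ ε := by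
    refine le_trans ?_ (hε Q hQw)
    unfold mixCorr
    rw [← Finset.expect_sub_distrib]
    refine (Finset.abs_expect_le _ _).trans (Finset.expect_le_expect fun x _ => ?_)
    have : G x * h x - 𝔼 y, G x * h (mix Q x y) = 𝔼 y, G x * (h x - h (mix Q x y)) := by
      simp only [mul_sub, Finset.expect_sub_distrib, Fintype.expect_const]
    rw [this]
    refine (Finset.abs_expect_le _ _).trans (Finset.expect_le_expect fun y _ => ?_)
    rw [abs_mul]
    exact mul_le_of_le_one_left (abs_nonneg _) (hG1 x)
  calc _ ≤ _ := abs_sub_le _ (mixCorr G h Q) _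
    _ ≤ _ := by linarith

end Covariance

section Moments

set_option linter.unusedSectionVars false

variable {ι ν : Type} [Fintype ι] [DecidableEq ι] [Fintype ν] [DecidableEq ν]

/-- Statistics of at most `k` output bits in `T` are those of uniform bits. -/
def KInd (f : (ι → Bool) → (ν → Bool)) (T : Finset ν) (k : ℕ) : Prop :=
  ∀ T' ⊆ T, T'.card ≤ k → ∀ F : (ν → Bool) → ℝ,
    (∀ u v : ν → Bool, (∀ i ∈ T', u i = v i) → F u = F v) → 𝔼 x, F (f x) = 𝔼 u, F u

/-- The sum over `N` of the signs of the bits of `u`. -/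
def sgSum (N : Finset ν) (u : ν → Bool) : ℝ := ∑ i ∈ N, sg (u i)

lemma kInd_of_prob (f : (ι → Bool) → (ν → Bool)) (T : Finset ν) (k : ℕ)
    (h : ∀ T' ⊆ T, T'.card ≤ k → ∀ z : ν → Bool,
      𝔼 x, (if ∀ i ∈ T', f x i = z i then (1 : ℝ) else 0) = ((2 : ℝ) ^ T'.card)⁻¹) :
    KInd f T k := by
  intro T' hT' hk
  set e : (ν → Bool) → (ν → Bool) → ℝ := fun u z => if ∀ i ∈ T', u i = z i then 1 else 0 with he
  have hc : ∀ u, 𝔼 z, e u z = 𝔼 z, e (fun _ => false) z := fun u => by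
    rw [← expect_xo (fun z => e (fun _ => false) z) u]
    refine Finset.expect_congr rfl fun z _ => ?_
    refine if_congr (forall₂_congr fun i _ => ?_) rfl rfl
    rw [xo_apply]
    cases u i <;> cases z i <;> simp
  have key : ∀ F : (ν → Bool) → ℝ, (∀ u v : ν → Bool, (∀ i ∈ T', u i = v i) → F u = F v) →
      (𝔼 x, F (f x)) * 𝔼 z, e (fun _ => false) z = (𝔼 u, F u) * ((2 : ℝ) ^ T'.card)⁻¹ := by
    intro F hF
    have hL : (𝔼 x, F (f x)) * 𝔼 z, e (fun _ => false) z = 𝔼 x, 𝔼 z, F (f x) * e (f x) z := by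
      rw [Finset.expect_mul]
      exact Finset.expect_congr rfl fun x _ => by rw [← hc (f x), Finset.mul_expect]
    have hR : (𝔼 u, F u) * ((2 : ℝ) ^ T'.card)⁻¹ = 𝔼 z, 𝔼 x, F z * e (f x) z := by
      rw [Finset.expect_mul]
      exact Finset.expect_congr rfl fun z _ => by rw [← h T' hT' hk z, Finset.mul_expect]
    rw [hL, hR, Finset.expect_comm]
    refine Finset.expect_congr rfl fun z _ => Finset.expect_congr rfl fun x _ => ?_
    simp only [he]
    split_ifs with hz
    · rw [hF _ _ hz]
    · simp
  have h1 := key (fun _ => 1) fun _ _ _ => rfl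
  simp only [Fintype.expect_const, one_mul] at h1
  intro F hF
  have h2 := key F hF
  rw [h1] at h2
  exact mul_right_cancel₀ (by positivity) h2

lemma KInd.mono {f : (ι → Bool) → (ν → Bool)} {T : Finset ν} {k k' : ℕ} (h : KInd f T k)
    (hk : k' ≤ k) : KInd f T k' := fun T' hT' hc => h T' hT' (hc.trans hk)

lemma KInd.expect_sgSum_pow {f : (ι → Bool) → (ν → Bool)} {T : Finset ν} {k : ℕ} (h : KInd f T k)
    {N : Finset ν} (hN : N ⊆ T) {q : ℕ} (hq : q ≤ k) :
    𝔼 x, sgSum N (f x) ^ q = 𝔼 u, sgSum N u ^ q := by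
  simp only [sgSum, Finset.sum_pow', Finset.expect_sum_comm]
  refine Finset.sum_congr rfl fun p hp => ?_
  refine h (Finset.univ.image p) ?_ ?_ (fun u => ∏ a, sg (u (p a))) ?_
  · intro i hi
    obtain ⟨a, -, rfl⟩ := Finset.mem_image.1 hi
    exact hN (Fintype.mem_piFinset.1 hp a)
  · exact Finset.card_image_le.trans (by simpa using hq)
  · intro u v huv
    refine Finset.prod_congr rfl fun a _ => ?_
    rw [huv (p a) (Finset.mem_image_of_mem _ (Finset.mem_univ a))]

lemma expect_prod_coord (g : ν → Bool → ℝ) :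
    𝔼 u : ν → Bool, ∏ i, g i (u i) = ∏ i, (g i true + g i false) / 2 := by
  rw [Fintype.expect_eq_sum_div_card]
  have := Finset.prod_univ_sum (fun _ : ν => (Finset.univ : Finset Bool)) g
  rw [Fintype.piFinset_univ] at this
  rw [← this, Finset.prod_div_distrib]
  simp

lemma expect_exp_sgSum_le (N : Finset ν) (r : ℝ) :
    𝔼 u, Real.exp (r * sgSum N u) ≤ Real.exp (r ^ 2 * N.card / 2) := by
  have h1 : ∀ u : ν → Bool, Real.exp (r * sgSum N u) =
      ∏ i, if i ∈ N then Real.exp (r * sg (u i)) else 1 := fun u => by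
    rw [sgSum, Finset.mul_sum, Real.exp_sum, Finset.prod_ite_mem, Finset.univ_inter]
  simp_rw [h1]
  rw [expect_prod_coord fun i b => if i ∈ N then Real.exp (r * sg b) else 1]
  have h2 : ∀ i, ((if i ∈ N then Real.exp (r * sg true) else 1) +
      (if i ∈ N then Real.exp (r * sg false) else 1)) / 2 = if i ∈ N then Real.cosh r else 1 := by
    intro i
    split_ifs
    · rw [Real.cosh_eq]; simp [sg]; ring
    · norm_num
  simp_rw [h2]
  rw [Finset.prod_ite_mem, Finset.univ_inter, Finset.prod_const]
  refine (pow_le_pow_left₀ (Real.cosh_pos r).le (Real.cosh_le_exp_half_sq r) _).trans ?_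
  rw [← Real.exp_nat_mul]
  exact Real.exp_le_exp.2 (by linarith)

lemma expect_sgSum_pow_le (N : Finset ν) {r : ℝ} (hr : 0 < r) {q : ℕ} (hq : Even q) :
    𝔼 u, sgSum N u ^ q ≤ 2 * q.factorial / r ^ q * Real.exp (r ^ 2 * N.card / 2) := by
  have h1 : ∀ u, sgSum N u ^ q ≤ q.factorial / r ^ q *
      (Real.exp (r * sgSum N u) + Real.exp (-r * sgSum N u)) := fun u => by
    have h := Real.pow_div_factorial_le_exp (r * |sgSum N u|) (by positivity) q
    rw [mul_pow, hq.pow_abs, div_le_iff₀ (by positivity)] at h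
    rw [div_mul_eq_mul_div, le_div_iff₀ (by positivity), mul_comm]
    refine h.trans ?_
    rw [mul_comm]
    refine mul_le_mul_of_nonneg_left ?_ (by positivity)
    rcases abs_cases (sgSum N u) with ⟨h, -⟩ | ⟨h, -⟩ <;> rw [h]
    · linarith [Real.exp_pos (-r * sgSum N u)]
    · rw [mul_neg, ← neg_mul]; linarith [Real.exp_pos (r * sgSum N u)]
  refine (Finset.expect_le_expect fun u _ => h1 u).trans ?_
  rw [← Finset.mul_expect, Finset.expect_add_distrib]
  have h2 := expect_exp_sgSum_le N r
  have h3 := expect_exp_sgSum_le N (-r)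
  rw [neg_sq] at h3
  calc _ ≤ q.factorial / r ^ q * (Real.exp (r ^ 2 * N.card / 2) + Real.exp (r ^ 2 * N.card / 2)) :=
        mul_le_mul_of_nonneg_left (add_le_add h2 h3) (by positivity)
    _ = _ := by ring

lemma expect_sgSum_pow_le' (N : Finset ν) {p : ℕ} (hp : p ≠ 0) :
    𝔼 u, sgSum N u ^ (2 * p) ≤ 4 * (2 * p).factorial * (N.card : ℝ) ^ p := by
  rcases Nat.eq_zero_or_pos N.card with h | h
  · rw [Finset.card_eq_zero] at h
    subst h
    simp [sgSum, hp]
  · have hN : (0 : ℝ) < N.card := by exact_mod_cast h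
    refine (expect_sgSum_pow_le N (r := (Real.sqrt N.card)⁻¹) (by positivity)
      (even_two_mul p)).trans ?_
    rw [inv_pow, inv_pow, Real.sq_sqrt hN.le, pow_mul, Real.sq_sqrt hN.le, inv_mul_cancel₀ hN.ne',
      div_inv_eq_mul]
    have h2 : Real.exp (1 / 2) ≤ 2 := by
      have := Real.exp_one_lt_d9
      have h3 : Real.exp (1 / 2) ^ 2 = Real.exp 1 := by rw [← Real.exp_nat_mul]; norm_num
      nlinarith [Real.exp_pos (1 / 2)]
    calc _ ≤ 2 * ((2 * p).factorial : ℝ) * (N.card : ℝ) ^ p * 2 :=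
          mul_le_mul_of_nonneg_left h2 (by positivity)
      _ = _ := by ring

end Moments

section CharFun

lemma norm_exp_sub_sum_le_of_nonneg (z : ℂ) (hz : ‖z‖ = 1) (hre : z.re = 0) (k : ℕ) {x : ℝ}
    (hx : 0 ≤ x) :
    ‖Complex.exp (z * x) - ∑ j ∈ Finset.range k, (z * x) ^ j / j.factorial‖ ≤
      x ^ k / k.factorial := by
  induction k generalizing x with
  | zero =>
    simp [Complex.norm_exp, hre]
  | succ k ih =>
    have hd : ∀ x : ℝ, HasDerivAt (fun x : ℝ => Complex.exp (z * x) -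
        ∑ j ∈ Finset.range (k + 1), (z * x) ^ j / j.factorial)
        (z * (Complex.exp (z * x) - ∑ j ∈ Finset.range k, (z * x) ^ j / j.factorial)) x := by
      intro x
      have h0 : HasDerivAt (fun x : ℝ => z * (x : ℂ)) z x := by
        simpa using (Complex.ofRealCLM.hasDerivAt (x := x)).const_mul z
      have h1 := h0.cexp
      have h2 : HasDerivAt (fun x : ℝ => ∑ j ∈ Finset.range (k + 1), (z * x) ^ j / j.factorial)
          (∑ j ∈ Finset.range (k + 1), (j * (z * x) ^ (j - 1) * z) / j.factorial) x := by
        refine HasDerivAt.fun_sum fun j _ => ?_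
        exact (h0.pow j).div_const _
      refine (h1.sub h2).congr_deriv ?_
      rw [Finset.sum_range_succ']
      simp only [Nat.cast_zero, zero_mul, zero_div, add_zero, Nat.add_sub_cancel, mul_sub,
        Finset.mul_sum, Nat.factorial_succ, Nat.cast_mul]
      rw [mul_comm (Complex.exp _) z, sub_right_inj]
      refine Finset.sum_congr rfl fun j _ => ?_
      have : ((j + 1 : ℕ) : ℂ) ≠ 0 := Nat.cast_ne_zero.2 (by omega)
      have : (j.factorial : ℂ) ≠ 0 := Nat.cast_ne_zero.2 j.factorial_ne_zero
      field_simp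
    have hB : ∀ x : ℝ, HasDerivAt (fun x : ℝ => x ^ (k + 1) / (k + 1).factorial)
        (x ^ k / k.factorial) x := by
      intro x
      refine ((hasDerivAt_pow (k + 1) x).div_const ((k + 1).factorial : ℝ)).congr_deriv ?_
      rw [Nat.factorial_succ, Nat.add_sub_cancel, Nat.cast_mul]
      have : ((k + 1 : ℕ) : ℝ) ≠ 0 := by positivity
      field_simp
    refine image_norm_le_of_norm_deriv_right_le_deriv_boundary (a := 0) (b := x)
      (fun y _ => (hd y).continuousAt.continuousWithinAt) (fun y _ => (hd y).hasDerivWithinAt) ?_ hB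
      (fun y hy => ?_) (Set.right_mem_Icc.2 hx)
    · rw [Finset.sum_range_succ']; simp
    · rw [norm_mul, hz, one_mul]
      exact ih hy.1

/-- The point `e^{iθ}` of the unit circle. -/
def cis (θ : ℝ) : ℂ := Complex.exp (θ * Complex.I)

lemma cis_add (a b : ℝ) : cis (a + b) = cis a * cis b := by
  simp [cis, add_mul, Complex.exp_add]

lemma cis_zero : cis 0 = 1 := by simp [cis]

lemma norm_cis (a : ℝ) : ‖cis a‖ = 1 := Complex.norm_exp_ofReal_mul_I a

lemma cis_nat_mul (n : ℕ) (a : ℝ) : cis (n * a) = cis a ^ n := by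
  simp only [cis]; rw [← Complex.exp_nat_mul]; push_cast; ring_nf

lemma cis_neg (a : ℝ) : cis (-a) = (starRingEnd ℂ) (cis a) := by
  simp [cis, ← Complex.exp_conj]

lemma cis_two_pi_int (l : ℤ) : cis (2 * Real.pi * l) = 1 := by
  rw [cis, Complex.exp_eq_one_iff]
  exact ⟨l, by push_cast; ring⟩

lemma norm_cis_sub_sum_le (k : ℕ) (x : ℝ) :
    ‖cis x - ∑ j ∈ Finset.range k, (x * Complex.I) ^ j / j.factorial‖ ≤
      |x| ^ k / k.factorial := by
  rcases le_total 0 x with h | h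
  · have := norm_exp_sub_sum_le_of_nonneg Complex.I (by simp) (by simp) k h
    simpa [cis, mul_comm, abs_of_nonneg h] using this
  · have := norm_exp_sub_sum_le_of_nonneg (-Complex.I) (by simp) (by simp) k (neg_nonneg.2 h)
    simpa [cis, mul_comm, abs_of_nonpos h] using this

lemma two_div_pi_mul_le_norm_cis_sub_one {θ : ℝ} (h : |θ| ≤ Real.pi) :
    2 / Real.pi * |θ| ≤ ‖cis θ - 1‖ := by
  have h1 : ‖cis θ - 1‖ = 2 * |Real.sin (θ / 2)| := by
    rw [cis, mul_comm, Complex.norm_exp_I_mul_ofReal_sub_one]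
    simp
  rw [h1, Real.abs_sin_eq_sin_abs_of_abs_le_pi (by
    rw [abs_div, abs_two]; linarith [abs_nonneg θ]), abs_div, abs_two]
  have := Real.mul_le_sin (x := |θ| / 2) (by positivity) (by linarith)
  refine le_trans ?_ (mul_le_mul_of_nonneg_left (this) zero_le_two)
  linarith

lemma norm_expect_complex_le {γ : Type} [Fintype γ] (F : γ → ℂ) : ‖𝔼 x, F x‖ ≤ 𝔼 x, ‖F x‖ :=
  RCLike.norm_expect_le (K := ℂ)

/-- Variables with the same first `k - 1` moments have close characteristic functions. -/
lemma norm_expect_cis_sub_le {α β : Type} [Fintype α] [Fintype β] (Y : α → ℝ) (W : β → ℝ) {k : ℕ}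
    (hmom : ∀ q ≤ k, 𝔼 x, Y x ^ q = 𝔼 u, W u ^ q) (hk : Even k) (θ : ℝ) :
    ‖𝔼 x, cis (θ * Y x) - 𝔼 u, cis (θ * W u)‖ ≤ 2 * (|θ| ^ k / k.factorial * 𝔼 u, W u ^ k) := by
  have key {γ : Type} [Fintype γ] (V : γ → ℝ) : ‖𝔼 x, cis (θ * V x) -
      ∑ j ∈ Finset.range k, (θ * Complex.I) ^ j / j.factorial * ((𝔼 x, V x ^ j : ℝ) : ℂ)‖ ≤
      |θ| ^ k / k.factorial * 𝔼 x, V x ^ k := by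
    have e : ∑ j ∈ Finset.range k, (θ * Complex.I) ^ j / j.factorial * ((𝔼 x, V x ^ j : ℝ) : ℂ) =
        𝔼 x, ∑ j ∈ Finset.range k, (((θ * V x : ℝ) : ℂ) * Complex.I) ^ j / j.factorial := by
      rw [Finset.expect_sum_comm]
      refine Finset.sum_congr rfl fun j _ => ?_
      have : ((𝔼 x, V x ^ j : ℝ) : ℂ) = 𝔼 x, (V x : ℂ) ^ j := by
        rw [Complex.ofReal_expect]; simp
      rw [this, Finset.mul_expect]
      refine Finset.expect_congr rfl fun x _ => ?_
      push_cast; ring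
    rw [e, ← Finset.expect_sub_distrib]
    refine (norm_expect_complex_le _).trans ?_
    rw [Finset.mul_expect]
    refine Finset.expect_le_expect fun x _ => ?_
    refine (norm_cis_sub_sum_le k _).trans (le_of_eq ?_)
    rw [abs_mul, mul_pow, hk.pow_abs (V x)]
    ring
  have h1 := key Y
  have h2 := key W
  rw [Finset.sum_congr rfl fun j hj => by rw [hmom j (Finset.mem_range.1 hj).le], hmom k le_rfl] at h1
  rw [two_mul]
  refine le_trans ?_ (add_le_add h1 h2)
  refine le_trans (le_of_eq ?_) (norm_sub_le _ _)
  rw [sub_sub_sub_cancel_right]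

end CharFun

section Fejer

lemma sum_range_two_mul_add_one_sub (g : ℤ → ℝ) (H : ℕ) :
    ∑ i ∈ Finset.range (2 * H + 1), g (i - H) =
      g 0 + ∑ i ∈ Finset.range H, (g (i + 1) + g (-(i + 1))) := by
  induction H with
  | zero => simp
  | succ H ih =>
    rw [Finset.sum_range_succ (fun i : ℕ => g (i + 1) + g (-(i + 1))), ← add_assoc, ← ih,
      show 2 * (H + 1) + 1 = (2 * H + 1 + 1) + 1 by ring, Finset.sum_range_succ,
      Finset.sum_range_succ']
    have e1 : ∀ i : ℕ, ((i + 1 : ℕ) : ℤ) - ((H + 1 : ℕ) : ℤ) = i - H := by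
      intro i; push_cast; ring
    have e2 : ((0 : ℕ) : ℤ) - ((H + 1 : ℕ) : ℤ) = -(H + 1) := by push_cast; ring
    have e3 : ((2 * H + 1 : ℕ) : ℤ) - (H : ℤ) = H + 1 := by push_cast; ring
    simp only [e1, e2, e3]
    abel

/-- The Fejér kernel of order `n` on the integers modulo `M`. -/
def fejer (M n : ℕ) (u : ℤ) : ℝ :=
  ‖∑ j ∈ Finset.range n, cis (2 * Real.pi * u / M) ^ j‖ ^ 2 / (M * n)

lemma fejer_nonneg (M n : ℕ) (u : ℤ) : 0 ≤ fejer M n u := by unfold fejer; positivity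

lemma fejer_eq (M n : ℕ) (u : ℤ) : (fejer M n u : ℂ) = (∑ j ∈ Finset.range n,
    ∑ l ∈ Finset.range n, cis (2 * Real.pi * ((j : ℝ) - l) / M * u)) / (M * n) := by
  have h : ((‖∑ j ∈ Finset.range n, cis (2 * Real.pi * u / M) ^ j‖ ^ 2 : ℝ) : ℂ) =
      ∑ j ∈ Finset.range n, ∑ l ∈ Finset.range n, cis (2 * Real.pi * ((j : ℝ) - l) / M * u) := by
    push_cast
    rw [← Complex.mul_conj', map_sum, Finset.sum_mul_sum]
    refine Finset.sum_congr rfl fun j _ => Finset.sum_congr rfl fun l _ => ?_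
    rw [← cis_nat_mul, ← cis_nat_mul, ← cis_neg, ← cis_add]
    congr 1
    ring
  unfold fejer
  push_cast at h ⊢
  rw [h]

lemma sum_cis_mul_sub (θ : ℝ) (H p : ℕ) (h : cis θ ≠ 1) :
    ∑ i ∈ Finset.range p, cis (θ * ((i - H : ℤ) : ℝ)) =
      cis (-(θ * H)) * ((cis (θ * p) - 1) / (cis θ - 1)) := by
  have : ∀ i : ℕ, cis (θ * ((i - H : ℤ) : ℝ)) = cis (-(θ * H)) * cis θ ^ i := by
    intro i
    rw [← cis_nat_mul, ← cis_add]
    congr 1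
    push_cast; ring
  simp only [this]
  rw [← Finset.mul_sum, geom_sum_eq h, mul_comm θ p, cis_nat_mul]

lemma cis_ne_one {θ : ℝ} (h : |θ| ≤ Real.pi) (h0 : θ ≠ 0) : cis θ ≠ 1 := by
  intro h1
  have := two_div_pi_mul_le_norm_cis_sub_one h
  rw [h1, sub_self, norm_zero] at this
  have : 0 < 2 / Real.pi * |θ| := by have := Real.pi_pos; positivity
  linarith

lemma abs_two_pi_sub_div_le {M n j l : ℕ} (hM : 2 * n ≤ M) (hj : j < n) (hl : l < n) :
    |2 * Real.pi * ((j : ℝ) - l) / M| ≤ 2 * Real.pi * n / M := by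
  have h1 : (0 : ℝ) < M := by exact_mod_cast (by omega : 0 < M)
  rw [abs_div, abs_mul, abs_of_pos h1, abs_of_pos Real.two_pi_pos]
  have : |(j : ℝ) - l| ≤ n := by
    have h1 : (j : ℝ) ≤ n := by exact_mod_cast hj.le
    have h2 : (l : ℝ) ≤ n := by exact_mod_cast hl.le
    rw [abs_le]; constructor <;> linarith [(Nat.cast_nonneg j : (0 : ℝ) ≤ j),
      (Nat.cast_nonneg l : (0 : ℝ) ≤ l)]
  have := Real.two_pi_pos
  gcongr

lemma two_pi_mul_div_le_pi {M n : ℕ} (hM : 2 * n ≤ M) : 2 * Real.pi * n / M ≤ Real.pi := by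
  rcases Nat.eq_zero_or_pos M with h | h
  · subst h; simp [Real.pi_pos.le]
  have h1 : (0 : ℝ) < M := by exact_mod_cast h
  rw [div_le_iff₀ h1]
  have : (2 * n : ℝ) ≤ M := by exact_mod_cast hM
  nlinarith [Real.pi_pos]

lemma sum_fejer {H n : ℕ} (hn : 0 < n) (hM : 2 * n ≤ 2 * H + 1) :
    ∑ i ∈ Finset.range (2 * H + 1), fejer (2 * H + 1) n (i - H) = 1 := by
  have hM0 : ((2 * H + 1 : ℕ) : ℝ) ≠ 0 := by positivity
  have hn0 : (n : ℂ) ≠ 0 := by exact_mod_cast hn.ne'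
  have key : ((∑ i ∈ Finset.range (2 * H + 1), fejer (2 * H + 1) n (i - H) : ℝ) : ℂ) = 1 := by
    push_cast
    simp only [fejer_eq]
    rw [← Finset.sum_div, Finset.sum_comm]
    have : ∀ j ∈ Finset.range n, ∑ i ∈ Finset.range (2 * H + 1), ∑ l ∈ Finset.range n,
        cis (2 * Real.pi * ((j : ℝ) - l) / (2 * H + 1 : ℕ) * ((i - H : ℤ) : ℝ)) =
        (2 * H + 1 : ℕ) := by
      intro j hj
      rw [Finset.sum_comm, Finset.sum_eq_single_of_mem j hj]
      · simp [cis_zero]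
      intro l hl hlj
      have hb := abs_two_pi_sub_div_le hM (Finset.mem_range.1 hj) (Finset.mem_range.1 hl)
      rw [sum_cis_mul_sub _ _ _ (cis_ne_one (hb.trans (two_pi_mul_div_le_pi hM)) ?_),
        div_mul_cancel₀ _ hM0]
      · have := cis_two_pi_int (j - l)
        push_cast at this
        rw [this]; simp
      · refine div_ne_zero (mul_ne_zero Real.two_pi_pos.ne' (sub_ne_zero.2 ?_)) hM0
        exact_mod_cast hlj.symm
    rw [Finset.sum_congr rfl this]
    have hM1 : ((2 * H + 1 : ℕ) : ℂ) ≠ 0 := by exact_mod_cast hM0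
    rw [Finset.sum_const, Finset.card_range, nsmul_eq_mul]
    field_simp
  exact_mod_cast key

lemma fejer_le {H n : ℕ} (hn : 0 < n) {u : ℤ} (hu0 : u ≠ 0) (hu : |u| ≤ H) :
    fejer (2 * H + 1) n u ≤ ((2 * H + 1 : ℕ) : ℝ) / (4 * n) * ((u : ℝ) ^ 2)⁻¹ := by
  set M : ℕ := 2 * H + 1 with hMdef
  have hM : (0 : ℝ) < M := by positivity
  have hn' : (0 : ℝ) < n := by exact_mod_cast hn
  have hu1 : (0 : ℝ) < |(u : ℝ)| := by positivity
  have huH : |(u : ℝ)| ≤ H := by exact_mod_cast hu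
  have hθ : |2 * Real.pi * u / M| = 2 * Real.pi * |(u : ℝ)| / M := by
    rw [abs_div, abs_mul, abs_of_pos hM, abs_of_pos Real.two_pi_pos]
  have hle : |2 * Real.pi * u / M| ≤ Real.pi := by
    rw [hθ, div_le_iff₀ hM, hMdef]
    push_cast
    nlinarith [Real.pi_pos]
  have hne : cis (2 * Real.pi * u / M) ≠ 1 := cis_ne_one hle (by
    have := Real.pi_pos; positivity)
  have h1 : ‖∑ j ∈ Finset.range n, cis (2 * Real.pi * u / M) ^ j‖ ≤ M / (2 * |(u : ℝ)|) := by
    rw [geom_sum_eq hne, norm_div]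
    have h2 := two_div_pi_mul_le_norm_cis_sub_one hle
    have h3 : ‖cis (2 * Real.pi * u / M) ^ n - 1‖ ≤ 2 := by
      refine (norm_sub_le _ _).trans ?_
      rw [norm_pow, norm_cis]; norm_num
    have h4 : 2 / Real.pi * |2 * Real.pi * u / M| = 4 * |(u : ℝ)| / M := by
      rw [hθ]; have := Real.pi_pos; field_simp; ring
    rw [h4] at h2
    have h5 : 0 < 4 * |(u : ℝ)| / M := by positivity
    calc _ ≤ 2 / (4 * |(u : ℝ)| / M) := div_le_div₀ zero_le_two h3 h5 h2
      _ = _ := by field_simp; ring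
  unfold fejer
  calc _ ≤ (M / (2 * |(u : ℝ)|)) ^ 2 / (M * n) := by gcongr
    _ = _ := by rw [← sq_abs (u : ℝ)]; field_simp; ring

lemma sum_fejer_tail {H n a : ℕ} (hn : 0 < n) (ha : 0 < a) :
    ∑ i ∈ Finset.range (2 * H + 1),
      (if (a : ℤ) < |(i - H : ℤ)| then fejer (2 * H + 1) n (i - H) else 0) ≤
      ((2 * H + 1 : ℕ) : ℝ) / (2 * n * a) := by
  rw [sum_range_two_mul_add_one_sub (fun u => if (a : ℤ) < |u| then fejer (2 * H + 1) n u else 0)]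
  have hn' : (0 : ℝ) < n := by exact_mod_cast hn
  have ha' : (0 : ℝ) < a := by exact_mod_cast ha
  set c : ℝ := ((2 * H + 1 : ℕ) : ℝ) / (4 * n) with hc
  have hc0 : 0 ≤ c := by positivity
  have hb : ∀ i ∈ Finset.range H, ((if (a : ℤ) < |(i + 1 : ℤ)| then
      fejer (2 * H + 1) n (i + 1) else 0) + (if (a : ℤ) < |(-(i + 1) : ℤ)| then
      fejer (2 * H + 1) n (-(i + 1)) else 0)) ≤
      if a < i + 1 then 2 * c * (((i + 1 : ℕ) : ℝ) ^ 2)⁻¹ else 0 := by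
    intro i hi
    have hi := Finset.mem_range.1 hi
    have e : |(i + 1 : ℤ)| = i + 1 := abs_of_nonneg (by positivity)
    rw [abs_neg, e]
    by_cases h : a < i + 1
    · have h' : (a : ℤ) < i + 1 := by exact_mod_cast h
      rw [if_pos h', if_pos h', if_pos h]
      have h1 := fejer_le (H := H) hn (u := i + 1) (by positivity) (by rw [e]; exact_mod_cast hi)
      have h2 := fejer_le (H := H) hn (u := -(i + 1)) (by
        have : (0 : ℤ) < i + 1 := by positivity
        omega) (by rw [abs_neg, e]; exact_mod_cast hi)
      push_cast at h1 h2 ⊢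
      rw [neg_sq] at h2
      push_cast at hc
      rw [← hc] at h1 h2
      linarith
    · have h' : ¬ (a : ℤ) < i + 1 := by exact_mod_cast h
      simp [h', h]
  refine (add_le_add (if_neg (by simp)).le (Finset.sum_le_sum hb)).trans ?_
  rw [zero_add, ← Finset.sum_filter, ← Finset.mul_sum]
  have : ∑ i ∈ (Finset.range H).filter (fun i => a < i + 1), (((i + 1 : ℕ) : ℝ) ^ 2)⁻¹ ≤
      (a : ℝ)⁻¹ := by
    rcases le_or_gt a H with haH | haH
    · have h1 := sum_Ioc_inv_sq_le_sub (α := ℝ) ha.ne' haH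
      refine le_trans (le_of_eq ?_) (h1.trans (sub_le_self _ (by positivity)))
      refine Finset.sum_bij (fun i _ => i + 1) ?_ ?_ ?_ ?_
      · intro i hi; simp at hi ⊢; omega
      · intro i _ j _ h; omega
      · intro i hi
        rw [Finset.mem_Ioc] at hi
        exact ⟨i - 1, by simp; omega, by omega⟩
      · intro i _; rfl
    · rw [Finset.filter_false_of_mem]
      · simp
      · intro i hi; rw [Finset.mem_range] at hi; omega
  calc _ ≤ 2 * c * (a : ℝ)⁻¹ := by gcongr
    _ = _ := by rw [hc]; field_simp; ring

/-- If `D ≥ Δ - 2ab` on a window where a unit-mass kernel has most of its mass and `|D| ≤ Δ`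
everywhere, then the smoothing of `D` is at least `Δ/2 - 2ab`. -/
lemma half_le_sum_mul_of_tail {κ : Type} (s : Finset κ) (p : κ → Prop) [DecidablePred p]
    {F D : κ → ℝ} {Δ b : ℝ} (hF : ∀ i ∈ s, 0 ≤ F i) (hF1 : ∑ i ∈ s, F i = 1)
    (hT : ∑ i ∈ s, (if p i then F i else 0) ≤ 1 / 4) (hb : 0 ≤ b)
    (hD : ∀ i ∈ s, |D i| ≤ Δ) (hΔ : 0 ≤ Δ)
    (hw : ∀ i ∈ s, ¬ p i → Δ - b ≤ D i) : Δ / 2 - b ≤ ∑ i ∈ s, F i * D i := by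
  have h : ∀ i ∈ s, F i * (Δ - b) - 2 * Δ * (if p i then F i else 0) ≤ F i * D i := by
    intro i hi
    by_cases hp : p i
    · rw [if_pos hp]
      have := neg_le_of_abs_le (hD i hi)
      nlinarith [hF i hi, mul_nonneg (hF i hi) hb, mul_le_mul_of_nonneg_left this (hF i hi)]
    · rw [if_neg hp]
      have := mul_le_mul_of_nonneg_left (hw i hi hp) (hF i hi)
      linarith
  have h2 := Finset.sum_le_sum h
  rw [Finset.sum_sub_distrib, ← Finset.sum_mul, ← Finset.mul_sum, hF1] at h2
  nlinarith [mul_le_mul_of_nonneg_left hT hΔ]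

end Fejer

section Kolmogorov

variable {α β : Type} [Fintype α] [Fintype β] [Nonempty α] [Nonempty β]

lemma norm_expect_sum_cis_sub_le (Z : α → ℕ) (B : β → ℕ) {P H k : ℕ} {σ : ℝ}
    (hZ : ∀ x, Z x ≤ P) (hB : ∀ u, B u ≤ P) (hmean : 𝔼 x, (Z x : ℝ) = 𝔼 u, (B u : ℝ))
    (hσ : 0 ≤ σ) (hk : k ≠ 0)
    (hchar : ∀ θ : ℝ, ‖𝔼 x, cis (θ * Z x) - 𝔼 u, cis (θ * B u)‖ ≤ 4 * (|θ| * σ) ^ k)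
    {θ : ℝ} (hθ : |θ| ≤ Real.pi) (hθσ : |θ| * σ ≤ 1 / 2) :
    ‖𝔼 x, ∑ i ∈ Finset.range (P - Z x), cis (θ * ((i - H : ℤ) : ℝ)) -
      𝔼 u, ∑ i ∈ Finset.range (P - B u), cis (θ * ((i - H : ℤ) : ℝ))‖ ≤
      4 * Real.pi * σ * (1 / 2) ^ k := by
  have hpi := Real.pi_pos
  by_cases h0 : θ = 0
  · subst h0
    have e {γ : Type} [Fintype γ] [Nonempty γ] (V : γ → ℕ) (hV : ∀ x, V x ≤ P) :
        𝔼 x, ∑ i ∈ Finset.range (P - V x), cis (0 * ((i - H : ℤ) : ℝ)) =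
          P - ((𝔼 x, (V x : ℝ) : ℝ) : ℂ) := by
      simp only [zero_mul, cis_zero, Finset.sum_const, Finset.card_range, nsmul_eq_mul, mul_one]
      rw [Complex.ofReal_expect, Finset.expect_congr rfl fun x _ => Nat.cast_sub (hV x),
        Finset.expect_sub_distrib, Fintype.expect_const]
      simp
    rw [e Z hZ, e B hB, hmean, sub_self, norm_zero]
    positivity
  · have hne := cis_ne_one hθ h0
    have e {γ : Type} [Fintype γ] [Nonempty γ] (V : γ → ℕ) (hV : ∀ x, V x ≤ P) :
        𝔼 x, ∑ i ∈ Finset.range (P - V x), cis (θ * ((i - H : ℤ) : ℝ)) =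
          cis (-(θ * H)) / (cis θ - 1) * (cis (θ * P) * 𝔼 x, cis (-θ * V x) - 1) := by
      have : ∀ x, ∑ i ∈ Finset.range (P - V x), cis (θ * ((i - H : ℤ) : ℝ)) =
          cis (-(θ * H)) / (cis θ - 1) * (cis (θ * P) * cis (-θ * V x) - 1) := by
        intro x
        rw [sum_cis_mul_sub _ _ _ hne, Nat.cast_sub (hV x), ← cis_add]
        ring_nf
      rw [Finset.expect_congr rfl fun x _ => this x, ← Finset.mul_expect,
        Finset.expect_sub_distrib, ← Finset.mul_expect, Fintype.expect_const]
    rw [e Z hZ, e B hB, ← mul_sub, sub_sub_sub_cancel_right, ← mul_sub, norm_mul, norm_mul,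
      norm_div, norm_cis, norm_cis, one_mul]
    have h1 := hchar (-θ)
    rw [abs_neg] at h1
    have hθ0 : 0 < |θ| := abs_pos.2 h0
    have h2 := two_div_pi_mul_le_norm_cis_sub_one hθ
    have h3 : 0 < 2 / Real.pi * |θ| := by positivity
    obtain ⟨k, rfl⟩ := Nat.exists_eq_succ_of_ne_zero hk
    calc _ ≤ 1 / (2 / Real.pi * |θ|) * (4 * (|θ| * σ) ^ (k + 1)) := by gcongr
      _ = 2 * Real.pi * σ * (|θ| * σ) ^ k := by field_simp; ring
      _ ≤ 2 * Real.pi * σ * (1 / 2) ^ k := by gcongr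
      _ = _ := by rw [pow_succ]; ring

lemma abs_expect_sum_fejer_sub_le (Z : α → ℕ) (B : β → ℕ) {P H n k : ℕ} {σ : ℝ}
    (hZ : ∀ x, Z x ≤ P) (hB : ∀ u, B u ≤ P) (hmean : 𝔼 x, (Z x : ℝ) = 𝔼 u, (B u : ℝ))
    (hσ : 0 ≤ σ) (hk : k ≠ 0)
    (hchar : ∀ θ : ℝ, ‖𝔼 x, cis (θ * Z x) - 𝔼 u, cis (θ * B u)‖ ≤ 4 * (|θ| * σ) ^ k)
    (hn : 0 < n) (hM : 2 * n ≤ 2 * H + 1) (hnσ : 4 * Real.pi * σ * n ≤ (2 * H + 1 : ℕ)) :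
    |𝔼 x, ∑ i ∈ Finset.range (P - Z x), fejer (2 * H + 1) n (i - H) -
      𝔼 u, ∑ i ∈ Finset.range (P - B u), fejer (2 * H + 1) n (i - H)| ≤ (1 / 2) ^ k := by
  have hpi := Real.pi_pos
  have hn' : (0 : ℝ) < n := by exact_mod_cast hn
  have hM0 : (0 : ℝ) < (2 * H + 1 : ℕ) := by positivity
  have e {γ : Type} [Fintype γ] (V : γ → ℕ) :
      ((𝔼 x, ∑ i ∈ Finset.range (P - V x), fejer (2 * H + 1) n (i - H) : ℝ) : ℂ) =
        (∑ j ∈ Finset.range n, ∑ l ∈ Finset.range n, 𝔼 x, ∑ i ∈ Finset.range (P - V x),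
          cis (2 * Real.pi * ((j : ℝ) - l) / (2 * H + 1 : ℕ) * ((i - H : ℤ) : ℝ))) /
          ((2 * H + 1 : ℕ) * n) := by
    rw [Complex.ofReal_expect, div_eq_mul_inv]
    simp only [← Finset.expect_sum_comm]
    rw [Finset.expect_mul]
    refine Finset.expect_congr rfl fun x _ => ?_
    push_cast
    have := fun u : ℤ => fejer_eq (2 * H + 1) n u
    push_cast at this
    simp only [this]
    rw [← Finset.sum_div, div_eq_mul_inv, Finset.sum_comm]
    congr 1
    refine Finset.sum_congr rfl fun j _ => ?_
    rw [Finset.sum_comm]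
    push_cast
    rfl
  rw [← Real.norm_eq_abs, ← Complex.norm_real, Complex.ofReal_sub, e Z, e B, ← sub_div,
    ← Finset.sum_sub_distrib, norm_div, norm_mul, Complex.norm_natCast, Complex.norm_natCast,
    div_le_iff₀ (by positivity)]
  refine (norm_sum_le _ _).trans ?_
  have : ∀ j ∈ Finset.range n, ‖∑ l ∈ Finset.range n, 𝔼 x, ∑ i ∈ Finset.range (P - Z x),
      cis (2 * Real.pi * ((j : ℝ) - l) / (2 * H + 1 : ℕ) * ((i - H : ℤ) : ℝ)) -
      ∑ l ∈ Finset.range n, 𝔼 x, ∑ i ∈ Finset.range (P - B x),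
      cis (2 * Real.pi * ((j : ℝ) - l) / (2 * H + 1 : ℕ) * ((i - H : ℤ) : ℝ))‖ ≤
      n * (4 * Real.pi * σ * (1 / 2) ^ k) := by
    intro j hj
    rw [← Finset.sum_sub_distrib]
    refine (norm_sum_le _ _).trans ((Finset.sum_le_sum (g := fun _ =>
      4 * Real.pi * σ * (1 / 2) ^ k) fun l hl => ?_).trans (by simp))
    have hb := abs_two_pi_sub_div_le hM (Finset.mem_range.1 hj) (Finset.mem_range.1 hl)
    refine norm_expect_sum_cis_sub_le Z B hZ hB hmean hσ hk hchar
      (hb.trans (two_pi_mul_div_le_pi hM)) ((mul_le_mul_of_nonneg_right hb hσ).trans ?_)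
    rw [div_mul_eq_mul_div, div_le_iff₀ hM0]
    linarith
  refine (Finset.sum_le_sum this).trans ?_
  rw [Finset.sum_const, Finset.card_range, nsmul_eq_mul]
  have h5 : (0 : ℝ) ≤ n * (1 / 2) ^ k := by positivity
  nlinarith [mul_le_mul_of_nonneg_right hnσ h5]

/-- A discrete Berry–Esseen type bound: integer random variables with close characteristic
functions, one of which is spread out, are close in Kolmogorov distance. -/
theorem abs_expect_le_sub_expect_le_le (Z : α → ℕ) (B : β → ℕ) {N k : ℕ} {σ b : ℝ}
    (hZ : ∀ x, Z x ≤ N) (hB : ∀ u, B u ≤ N) (hmean : 𝔼 x, (Z x : ℝ) = 𝔼 u, (B u : ℝ))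
    (hσ : 1 / 2 ≤ σ) (hk : k ≠ 0)
    (hchar : ∀ θ : ℝ, ‖𝔼 x, cis (θ * Z x) - 𝔼 u, cis (θ * B u)‖ ≤ 4 * (|θ| * σ) ^ k)
    (hb : ∀ v : ℤ, 𝔼 u, (if (B u : ℤ) = v then (1 : ℝ) else 0) ≤ b) (s : ℤ) :
    |𝔼 x, (if s ≤ (Z x : ℤ) then (1 : ℝ) else 0) - 𝔼 u, (if s ≤ (B u : ℤ) then (1 : ℝ) else 0)| ≤
      212 * σ * b + 2 * (1 / 2) ^ k := by
  have hpi := Real.pi_pos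
  have hpi3 := Real.pi_gt_three
  have hpi4 := Real.pi_lt_d2
  have hb0 : 0 ≤ b := (Finset.expect_nonneg fun u _ => by split_ifs <;> norm_num).trans (hb 0)
  set D : ℤ → ℝ := fun s => 𝔼 x, (if s ≤ (Z x : ℤ) then (1 : ℝ) else 0) -
    𝔼 u, (if s ≤ (B u : ℤ) then (1 : ℝ) else 0) with hD
  have hDlow : ∀ s : ℤ, s ≤ 0 → D s = 0 := by
    intro s hs
    have h1 : ∀ v : ℕ, s ≤ (v : ℤ) := fun v => hs.trans (by positivity)
    simp [hD, h1]
  have hDhigh : ∀ s : ℤ, (N : ℤ) < s → D s = 0 := by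
    intro s hs
    have h1 : ∀ x, ¬ s ≤ (Z x : ℤ) := fun x => by have := hZ x; omega
    have h2 : ∀ x, ¬ s ≤ (B x : ℤ) := fun x => by have := hB x; omega
    simp [hD, h1, h2]
  obtain ⟨t0, ht0, hmax0⟩ := Finset.exists_max_image (Finset.Icc (0 : ℤ) (N + 1)) (fun s => |D s|)
    ⟨0, by simp; positivity⟩
  rw [Finset.mem_Icc] at ht0
  have hmax : ∀ s, |D s| ≤ |D t0| := by
    intro s
    rcases le_or_gt s 0 with h | h
    · rw [hDlow s h, abs_zero]; exact abs_nonneg _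
    rcases le_or_gt s (N + 1) with h' | h'
    · exact hmax0 s (by simp; omega)
    · rw [hDhigh s (by omega), abs_zero]; exact abs_nonneg _
  have hstepB : ∀ s : ℤ, ∀ q : ℕ, 𝔼 u, (if s ≤ (B u : ℤ) then (1 : ℝ) else 0) -
      𝔼 u, (if s + q ≤ (B u : ℤ) then (1 : ℝ) else 0) ≤ q * b := by
    intro s q
    induction q with
    | zero => simp
    | succ q ih =>
      have h1 : 𝔼 u, (if s + q ≤ (B u : ℤ) then (1 : ℝ) else 0) -
          𝔼 u, (if s + (q + 1 : ℕ) ≤ (B u : ℤ) then (1 : ℝ) else 0) ≤ b := by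
        refine le_trans ?_ (hb (s + q))
        rw [← Finset.expect_sub_distrib]
        refine Finset.expect_le_expect fun u _ => ?_
        push_cast
        split_ifs <;> first | omega | norm_num
      push_cast at h1 ih ⊢
      linarith
  have hstep : ∀ s : ℤ, ∀ q : ℕ, D (s + q) ≤ D s + q * b := by
    intro s q
    have h1 := hstepB s q
    have h2 : 𝔼 x, (if s + q ≤ (Z x : ℤ) then (1 : ℝ) else 0) ≤
        𝔼 x, (if s ≤ (Z x : ℤ) then (1 : ℝ) else 0) :=
      Finset.expect_le_expect fun x _ => by split_ifs <;> first | omega | norm_num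
    simp only [hD]
    linarith
  set a : ℕ := ⌈51 * σ⌉₊ with ha
  have ha1 : 51 * σ ≤ a := Nat.le_ceil _
  have ha2 : (a : ℝ) ≤ 53 * σ := by
    have := Nat.ceil_lt_add_one (a := 51 * σ) (by linarith)
    linarith
  have ha0 : 0 < a := by rw [ha, Nat.ceil_pos]; linarith
  set H : ℕ := N + 1 + a + ⌈4 * Real.pi * σ⌉₊ with hH
  have hHσ : 4 * Real.pi * σ ≤ H := by
    have := Nat.le_ceil (4 * Real.pi * σ)
    rw [hH]; push_cast
    have h1 : (0 : ℝ) ≤ N := Nat.cast_nonneg _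
    have h2 : (0 : ℝ) ≤ a := Nat.cast_nonneg _
    linarith
  set n : ℕ := ⌊(2 * H + 1 : ℝ) / (4 * Real.pi * σ)⌋₊ with hn
  have hpos : 0 < 4 * Real.pi * σ := by positivity
  have hx1 : 1 ≤ (2 * H + 1 : ℝ) / (4 * Real.pi * σ) := by
    rw [le_div_iff₀ hpos]; linarith
  have hn0 : 0 < n := Nat.floor_pos.2 hx1
  have hn0' : (0 : ℝ) < n := by exact_mod_cast hn0
  have hnle : (n : ℝ) ≤ (2 * H + 1 : ℝ) / (4 * Real.pi * σ) := Nat.floor_le (by positivity)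
  have hnge : (2 * H + 1 : ℝ) / (4 * Real.pi * σ) ≤ 2 * n := by
    have := Nat.lt_floor_add_one ((2 * H + 1 : ℝ) / (4 * Real.pi * σ))
    rw [← hn] at this
    have h1 : (1 : ℝ) ≤ n := by exact_mod_cast hn0
    linarith
  rw [le_div_iff₀ hpos] at hnle
  rw [div_le_iff₀ hpos] at hnge
  have hnσ : 4 * Real.pi * σ * n ≤ (2 * H + 1 : ℕ) := by push_cast; linarith
  have hM : 2 * n ≤ 2 * H + 1 := by
    have : (2 * n : ℝ) ≤ (2 * H + 1 : ℕ) := by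
      refine le_trans (mul_le_mul_of_nonneg_right ?_ hn0'.le) hnσ
      nlinarith
    exact_mod_cast this
  have htail : ∑ i ∈ Finset.range (2 * H + 1),
      (if (a : ℤ) < |(i - H : ℤ)| then fejer (2 * H + 1) n (i - H) else 0) ≤ 1 / 4 := by
    refine (sum_fejer_tail hn0 ha0).trans ?_
    have ha0' : (0 : ℝ) < a := by exact_mod_cast ha0
    rw [div_le_iff₀ (by positivity)]
    have h16 : 16 * Real.pi * σ ≤ a := by nlinarith
    push_cast
    nlinarith [mul_le_mul_of_nonneg_left h16 hn0'.le]
  have hsum := sum_fejer (H := H) hn0 hM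
  have hupper : ∀ t1 : ℤ, (N : ℤ) ≤ t1 + H → t1 ≤ H + 1 →
      |∑ i ∈ Finset.range (2 * H + 1), fejer (2 * H + 1) n (i - H) * D (t1 - (i - H))| ≤
        (1 / 2) ^ k := by
    intro t1 h1 h2
    obtain ⟨P, hP⟩ := Int.eq_ofNat_of_zero_le (by omega : 0 ≤ t1 + H)
    have hNP : N ≤ P := by omega
    refine le_trans (le_of_eq ?_) (abs_expect_sum_fejer_sub_le Z B (P := P)
      (fun x => (hZ x).trans hNP) (fun u => (hB u).trans hNP) hmean (by linarith) hk hchar hn0 hM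
      hnσ)
    rw [abs_sub_comm]
    congr 1
    have e {γ : Type} [Fintype γ] [Nonempty γ] (V : γ → ℕ) (hV : ∀ x, V x ≤ N) :
        ∑ i ∈ Finset.range (2 * H + 1), fejer (2 * H + 1) n (i - H) *
          𝔼 x, (if t1 - (i - H) ≤ (V x : ℤ) then (1 : ℝ) else 0) =
          1 - 𝔼 x, ∑ i ∈ Finset.range (P - V x), fejer (2 * H + 1) n (i - H) := by
      simp only [Finset.mul_expect]
      rw [← Finset.expect_sum_comm, eq_sub_iff_add_eq, ← Finset.expect_add_distrib]
      have : ∀ x, ∑ i ∈ Finset.range (2 * H + 1), fejer (2 * H + 1) n (i - H) *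
          (if t1 - (i - H) ≤ (V x : ℤ) then (1 : ℝ) else 0) +
          ∑ i ∈ Finset.range (P - V x), fejer (2 * H + 1) n (i - H) = 1 := by
        intro x
        have hVx := hV x
        refine Eq.trans ?_ hsum
        rw [← Finset.sum_filter_add_sum_filter_not (Finset.range (2 * H + 1))
          (fun i : ℕ => t1 - (i - H) ≤ (V x : ℤ)) (fun i => fejer (2 * H + 1) n (i - H))]
        congr 1
        · rw [Finset.sum_filter]
          exact Finset.sum_congr rfl fun i _ => by simp only [mul_ite, mul_one, mul_zero]
        · refine Finset.sum_congr ?_ fun _ _ => rfl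
          ext i
          simp only [Finset.mem_range, Finset.mem_filter]
          omega
      simp only [this, Fintype.expect_const]
    simp only [hD, mul_sub, Finset.sum_sub_distrib]
    rw [e Z hZ, e B hB]
    ring
  have hfin : |D t0| / 2 - 2 * a * b ≤ (1 / 2) ^ k := by
    rcases le_total 0 (D t0) with h | h
    · have h3 := half_le_sum_mul_of_tail (Finset.range (2 * H + 1))
        (fun i : ℕ => (a : ℤ) < |(i - H : ℤ)|) (F := fun i : ℕ => fejer (2 * H + 1) n (i - H))
        (D := fun i : ℕ => D (t0 - a - (i - H))) (Δ := |D t0|) (b := 2 * a * b)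
        (fun i _ => fejer_nonneg _ _ _) hsum htail (by positivity) (fun i _ => hmax _)
        (abs_nonneg _) (fun i _ hi => by
          rw [not_lt, abs_le] at hi
          obtain ⟨q, hq⟩ := Int.eq_ofNat_of_zero_le (by omega : 0 ≤ a + (i - H : ℤ))
          have h5 := hstep (t0 - a - (i - H)) q
          rw [show t0 - a - (i - H : ℤ) + q = t0 by omega] at h5
          have h6 : (q : ℝ) ≤ 2 * a := by exact_mod_cast (by omega : q ≤ 2 * a)
          rw [abs_of_nonneg h]
          nlinarith [mul_le_mul_of_nonneg_right h6 hb0])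
      exact h3.trans ((le_abs_self _).trans (hupper (t0 - a) (by omega) (by omega)))
    · have h3 := half_le_sum_mul_of_tail (Finset.range (2 * H + 1))
        (fun i : ℕ => (a : ℤ) < |(i - H : ℤ)|) (F := fun i : ℕ => fejer (2 * H + 1) n (i - H))
        (D := fun i : ℕ => -D (t0 + a - (i - H))) (Δ := |D t0|) (b := 2 * a * b)
        (fun i _ => fejer_nonneg _ _ _) hsum htail (by positivity)
        (fun i _ => by rw [abs_neg]; exact hmax _)
        (abs_nonneg _) (fun i _ hi => by
          rw [not_lt, abs_le] at hi
          obtain ⟨q, hq⟩ := Int.eq_ofNat_of_zero_le (by omega : 0 ≤ a - (i - H : ℤ))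
          have h5 := hstep t0 q
          rw [show t0 + q = t0 + a - (i - H : ℤ) by omega] at h5
          have h6 : (q : ℝ) ≤ 2 * a := by exact_mod_cast (by omega : q ≤ 2 * a)
          rw [abs_of_nonpos h]
          nlinarith [mul_le_mul_of_nonneg_right h6 hb0])
      refine h3.trans (le_trans ?_ (hupper (t0 + a) (by omega) (by omega)))
      simp only [mul_neg, Finset.sum_neg_distrib]
      exact neg_le_abs _
  refine (hmax s).trans ?_
  nlinarith [mul_le_mul_of_nonneg_right ha2 hb0]

end Kolmogorov

section Binomial

lemma centralBinom_sq_mul_le (n : ℕ) : n.centralBinom ^ 2 * (2 * n + 1) ≤ 16 ^ n := by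
  induction n with
  | zero => simp
  | succ n ih =>
    have h := Nat.succ_mul_centralBinom_succ n
    have h2 : ((n + 1) ^ 2) * ((n + 1).centralBinom ^ 2 * (2 * (n + 1) + 1)) ≤
        (n + 1) ^ 2 * 16 ^ (n + 1) := by
      calc _ = ((n + 1) * (n + 1).centralBinom) ^ 2 * (2 * n + 3) := by ring
        _ = 4 * (n.centralBinom ^ 2 * (2 * n + 1)) * ((2 * n + 1) * (2 * n + 3)) := by
          rw [h]; ring
        _ ≤ 4 * 16 ^ n * (4 * (n + 1) ^ 2) :=
          Nat.mul_le_mul (Nat.mul_le_mul_left 4 ih) (by nlinarith)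
        _ = _ := by ring
    exact Nat.le_of_mul_le_mul_left h2 (by positivity)

lemma centralBinom_div_le (n : ℕ) : (n.centralBinom : ℝ) / 4 ^ n ≤ 1 / Real.sqrt (2 * n + 1) := by
  have h : ((n.centralBinom ^ 2 * (2 * n + 1) : ℕ) : ℝ) ≤ (16 ^ n : ℕ) := by
    exact_mod_cast centralBinom_sq_mul_le n
  have hs : 0 < Real.sqrt (2 * n + 1) := Real.sqrt_pos.2 (by positivity)
  rw [div_le_div_iff₀ (by positivity) hs, one_mul]
  refine abs_le_of_sq_le_sq' ?_ (by positivity) |>.2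
  rw [mul_pow, Real.sq_sqrt (by positivity), ← pow_mul, mul_comm n 2, pow_mul]
  push_cast at h
  norm_num
  exact h

lemma choose_div_two_pow_le (N v : ℕ) (hN : N ≠ 0) :
    (N.choose v : ℝ) / 2 ^ N ≤ 1 / Real.sqrt N := by
  have h1 : (N.choose v : ℝ) ≤ N.choose (N / 2) := by exact_mod_cast Nat.choose_le_middle v N
  refine (div_le_div_of_nonneg_right h1 (by positivity)).trans ?_
  rcases Nat.even_or_odd' N with ⟨n, rfl | rfl⟩
  · have h2 := centralBinom_div_le n
    rw [Nat.centralBinom] at h2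
    rw [Nat.mul_div_cancel_left _ two_pos, pow_mul]
    norm_num at h2 ⊢
    refine h2.trans ?_
    have hn : 0 < n := by omega
    have : (0 : ℝ) < n := by exact_mod_cast hn
    have e : (Real.sqrt n)⁻¹ * (Real.sqrt 2)⁻¹ = 1 / Real.sqrt (2 * n) := by
      rw [Real.sqrt_mul zero_le_two]; field_simp
    rw [e, ← one_div]
    gcongr
    linarith
  · have h2 := centralBinom_div_le (n + 1)
    have h3 : (n + 1).centralBinom = 2 * (2 * n + 1).choose n := by
      rw [Nat.centralBinom, show 2 * (n + 1) = (2 * n + 1) + 1 by ring, Nat.choose_succ_succ,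
        Nat.choose_symm_half]
      ring
    rw [h3] at h2
    rw [show (2 * n + 1) / 2 = n by omega]
    have h4 : ((2 * n + 1).choose n : ℝ) / 2 ^ (2 * n + 1) =
        ((2 * (2 * n + 1).choose n : ℕ) : ℝ) / 4 ^ (n + 1) := by
      push_cast
      rw [pow_succ, pow_mul, pow_succ]
      norm_num
      field_simp
      ring
    rw [h4]
    refine h2.trans ?_
    push_cast
    gcongr
    linarith

end Binomial

section Count

variable {ι ν : Type} [Fintype ι] [DecidableEq ι] [Fintype ν] [DecidableEq ν]

/-- Number of ones of `u` on `T`. -/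
def ones (T : Finset ν) (u : ν → Bool) : ℕ := (T.filter fun i => u i = true).card

lemma ones_le (T : Finset ν) (u : ν → Bool) : ones T u ≤ T.card := Finset.card_filter_le _ _

lemma two_mul_ones (T : Finset ν) (u : ν → Bool) : 2 * (ones T u : ℝ) = T.card - sgSum T u := by
  have h : ∀ i, sg (u i) = 1 - 2 * (if u i = true then (1 : ℝ) else 0) := by
    intro i; cases u i <;> simp [sg]; norm_num
  simp only [sgSum, h, Finset.sum_sub_distrib, ← Finset.mul_sum, ones, Finset.card_filter]
  simp

lemma ones_insert {T : Finset ν} {i : ν} (hi : i ∉ T) (u : ν → Bool) :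
    ones (insert i T) u = ones T u + if u i = true then 1 else 0 := by
  unfold ones
  rw [Finset.filter_insert]
  split_ifs with h
  · rw [Finset.card_insert_of_notMem (by simp [hi])]
  · rfl

lemma ones_update_of_notMem {T : Finset ν} {i : ν} (hi : i ∉ T) (u : ν → Bool) (b : Bool) :
    ones T (Function.update u i b) = ones T u := by
  unfold ones
  congr 1
  refine Finset.filter_congr fun j hj => ?_
  rw [Function.update_of_ne (by rintro rfl; exact hi hj)]

lemma expect_ones_eq (T : Finset ν) (v : ℕ) :
    𝔼 u : ν → Bool, (if ones T u = v then (1 : ℝ) else 0) = T.card.choose v / 2 ^ T.card := by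
  induction T using Finset.induction_on generalizing v with
  | empty => cases v <;> simp [ones]
  | insert i T hi ih =>
    have key : 𝔼 u : ν → Bool, (if ones (insert i T) u = v then (1 : ℝ) else 0) =
        (𝔼 u : ν → Bool, (if ones T u = v then (1 : ℝ) else 0) +
          𝔼 u : ν → Bool, (if ones T u + 1 = v then (1 : ℝ) else 0)) / 2 := by
      have h1 := expect_flip (fun u : ν → Bool => if ones (insert i T) u = v then (1 : ℝ) else 0) i
      have h2 : 𝔼 u : ν → Bool, (if ones (insert i T) u = v then (1 : ℝ) else 0) +
          𝔼 u : ν → Bool, (if ones (insert i T) (Function.update u i (!(u i))) = v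
            then (1 : ℝ) else 0) = 𝔼 u : ν → Bool, (if ones T u = v then (1 : ℝ) else 0) +
          𝔼 u : ν → Bool, (if ones T u + 1 = v then (1 : ℝ) else 0) := by
        rw [← Finset.expect_add_distrib, ← Finset.expect_add_distrib]
        refine Finset.expect_congr rfl fun u _ => ?_
        rw [ones_insert hi, ones_insert hi, ones_update_of_notMem hi, Function.update_self]
        cases u i <;> simp [add_comm]
      rw [← h2, h1]; ring
    rw [key, ih, Finset.card_insert_of_notMem hi]
    cases v with
    | zero => simp; rw [pow_succ]; field_simp
    | succ v =>
      simp only [Nat.add_right_cancel_iff]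
      rw [ih, Nat.choose_succ_succ, pow_succ]
      push_cast
      field_simp
      ring

lemma expect_ones_eq_le {T : Finset ν} (hT : T.card ≠ 0) (v : ℤ) :
    𝔼 u : ν → Bool, (if (ones T u : ℤ) = v then (1 : ℝ) else 0) ≤ 1 / Real.sqrt T.card := by
  rcases le_or_gt 0 v with h | h
  · obtain ⟨v, rfl⟩ := Int.eq_ofNat_of_zero_le h
    simp only [Nat.cast_inj]
    rw [expect_ones_eq]
    exact choose_div_two_pow_le _ _ hT
  · have : ∀ u : ν → Bool, ¬ (ones T u : ℤ) = v := fun u => by omega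
    simp [this]

lemma norm_expect_cis_ones_sub_le {f : (ι → Bool) → ν → Bool} {T : Finset ν} {k : ℕ}
    (h : KInd f T k) (hk : Even k) (hk0 : k ≠ 0) (hkN : k ≤ T.card) (θ : ℝ) :
    ‖𝔼 x, cis (θ * ones T (f x)) - 𝔼 u, cis (θ * ones T u)‖ ≤
      4 * (|θ| * (Real.exp (1 / 2) / 2 * Real.sqrt (T.card / k))) ^ k := by
  have e {γ : Type} [Fintype γ] (V : γ → ν → Bool) : 𝔼 x, cis (θ * ones T (V x)) =
      cis (θ / 2 * T.card) * 𝔼 x, cis (-(θ / 2) * sgSum T (V x)) := by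
    rw [Finset.mul_expect]
    refine Finset.expect_congr rfl fun x _ => ?_
    rw [← cis_add]
    congr 1
    linear_combination θ / 2 * two_mul_ones T (V x)
  have hk' : (0 : ℝ) < k := by positivity
  have hT' : (0 : ℝ) < T.card := by exact_mod_cast (Nat.pos_of_ne_zero hk0).trans_le hkN
  rw [e f, e (fun u => u), ← mul_sub, norm_mul, norm_cis, one_mul]
  refine (norm_expect_cis_sub_le (fun x => sgSum T (f x)) (fun u => sgSum T u)
    (fun q hq => h.expect_sgSum_pow (Finset.Subset.refl _) hq) hk _).trans ?_
  have hr : 0 < Real.sqrt (k / T.card) := Real.sqrt_pos.2 (by positivity)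
  have h1 := expect_sgSum_pow_le T hr hk
  rw [Real.sq_sqrt (by positivity), div_mul_cancel₀ _ hT'.ne'] at h1
  have h2 : Real.exp ((k : ℝ) / 2) = Real.exp (1 / 2) ^ k := by
    rw [← Real.exp_nat_mul]; ring_nf
  have h3 : Real.sqrt (T.card / k) = 1 / Real.sqrt (k / T.card) := by
    rw [one_div, ← Real.sqrt_inv, inv_div]
  rw [abs_neg, abs_div, abs_two]
  have hf : (0 : ℝ) < k.factorial := by positivity
  calc _ ≤ 2 * ((|θ| / 2) ^ k / k.factorial * (2 * k.factorial / Real.sqrt (k / T.card) ^ k *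
        Real.exp (k / 2))) := by gcongr
    _ = 4 * ((|θ| / 2) ^ k / Real.sqrt (k / T.card) ^ k * Real.exp (k / 2)) := by
      field_simp; ring
    _ = _ := by
      rw [h2, h3, ← div_pow, ← mul_pow]
      congr 2
      field_simp

/-- `k`-wise independence gives a Kolmogorov bound for the number of ones. -/
theorem KInd.abs_expect_le_ones_sub_le {f : (ι → Bool) → ν → Bool} {T : Finset ν} {k : ℕ}
    (h : KInd f T k) (hk : Even k) (hk0 : k ≠ 0) (hkN : k ≤ T.card) (s : ℤ) :
    |𝔼 x, (if s ≤ (ones T (f x) : ℤ) then (1 : ℝ) else 0) -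
      𝔼 u, (if s ≤ (ones T u : ℤ) then (1 : ℝ) else 0)| ≤ 200 / Real.sqrt k := by
  have hk' : (0 : ℝ) < k := by positivity
  have hT' : (0 : ℝ) < T.card := by exact_mod_cast (Nat.pos_of_ne_zero hk0).trans_le hkN
  have hmean : 𝔼 x, (ones T (f x) : ℝ) = 𝔼 u, (ones T u : ℝ) := by
    have h1 := h.expect_sgSum_pow (N := T) (q := 1) (Finset.Subset.refl _) (by omega)
    simp only [pow_one] at h1
    have e : ∀ u, (ones T u : ℝ) = T.card / 2 - sgSum T u / 2 := fun u => by
      linarith [two_mul_ones T u]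
    simp only [e, Finset.expect_sub_distrib, ← Finset.expect_div, h1, Fintype.expect_const]
  have he1 : 1 ≤ Real.exp (1 / 2) := Real.one_le_exp (by norm_num)
  have he2 : Real.exp (1 / 2) ≤ 1.65 := by
    have h1 : Real.exp (1 / 2) ^ 2 = Real.exp 1 := by rw [← Real.exp_nat_mul]; norm_num
    have := Real.exp_one_lt_d9
    nlinarith
  have hs : 1 ≤ Real.sqrt (T.card / k) := by
    rw [Real.one_le_sqrt, one_le_div hk']; exact_mod_cast hkN
  have hmain := abs_expect_le_sub_expect_le_le (fun x => ones T (f x)) (fun u => ones T u)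
    (N := T.card) (k := k) (σ := Real.exp (1 / 2) / 2 * Real.sqrt (T.card / k))
    (fun x => ones_le _ _) (fun u => ones_le _ _) hmean (by nlinarith) hk0
    (norm_expect_cis_ones_sub_le h hk hk0 hkN) (expect_ones_eq_le (by exact_mod_cast hT'.ne')) s
  refine hmain.trans ?_
  have h2 : Real.sqrt (T.card / k) * (1 / Real.sqrt T.card) = 1 / Real.sqrt k := by
    rw [Real.sqrt_div' _ hk'.le]
    have := Real.sqrt_pos.2 hT'
    field_simp
  have h3 : (1 / 2 : ℝ) ^ k ≤ 1 / Real.sqrt k := by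
    rw [one_div_pow]
    refine one_div_le_one_div_of_le (Real.sqrt_pos.2 hk') ?_
    have : (k : ℝ) ≤ 2 ^ k := by exact_mod_cast Nat.lt_two_pow_self.le
    refine (Real.sqrt_le_sqrt this).trans ?_
    rw [Real.sqrt_le_left (by positivity)]
    have : (1 : ℝ) ≤ 2 ^ k := one_le_pow₀ one_le_two
    nlinarith
  calc _ = 106 * Real.exp (1 / 2) * (Real.sqrt (T.card / k) * (1 / Real.sqrt T.card)) +
        2 * (1 / 2) ^ k := by ring
    _ ≤ 106 * 1.65 * (1 / Real.sqrt k) + 2 * (1 / Real.sqrt k) := by rw [h2]; gcongr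
    _ ≤ _ := by
      rw [← add_mul, mul_one_div]
      gcongr
      norm_num

end Count

section Smooth

/-- The piecewise linear function that is `0` before `t` and `1` after `t + w`. -/
def ramp (t w z : ℝ) : ℝ := max 0 (min 1 ((z - t) / w))

lemma ramp_nonneg (t w z : ℝ) : 0 ≤ ramp t w z := le_max_left _ _

lemma ramp_le_one (t w z : ℝ) : ramp t w z ≤ 1 := max_le zero_le_one (min_le_left _ _)

lemma ramp_of_le {t w z : ℝ} (hw : 0 < w) (h : z ≤ t) : ramp t w z = 0 :=
  max_eq_left ((min_le_right _ _).trans (div_nonpos_of_nonpos_of_nonneg (by linarith) hw.le))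

lemma ramp_of_ge {t w z : ℝ} (hw : 0 < w) (h : t + w ≤ z) : ramp t w z = 1 := by
  rw [ramp, min_eq_left, max_eq_right zero_le_one]
  rw [le_div_iff₀ hw]; linarith

lemma abs_ramp_sub_le {t w : ℝ} (hw : 0 < w) (z z' : ℝ) :
    |ramp t w z - ramp t w z'| ≤ |z - z'| / w := by
  have h1 : |ramp t w z - ramp t w z'| ≤ |min 1 ((z - t) / w) - min 1 ((z' - t) / w)| := by
    refine (abs_max_sub_max_le_max _ _ _ _).trans ?_
    simp
  have h2 : |min 1 ((z - t) / w) - min 1 ((z' - t) / w)| ≤ |(z - t) / w - (z' - t) / w| := by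
    refine (abs_min_sub_min_le_max _ _ _ _).trans ?_
    simp
  refine h1.trans (h2.trans (le_of_eq ?_))
  rw [← sub_div, abs_div, abs_of_pos hw]
  ring_nf

lemma abs_ramp_sub_le_ite {t w s z z' : ℝ} (hw : 0 < w) (h : |z - z'| ≤ s) :
    |ramp t w z - ramp t w z'| ≤ s / w * (if t - s ≤ z ∧ z ≤ t + w + s then 1 else 0) := by
  have hs : 0 ≤ s := (abs_nonneg _).trans h
  split_ifs with hz
  · rw [mul_one]
    exact (abs_ramp_sub_le hw z z').trans (by gcongr)
  · rw [mul_zero]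
    rw [not_and_or, not_le, not_le] at hz
    rw [abs_le] at h
    rcases hz with hz | hz
    · rw [ramp_of_le hw (by linarith : z ≤ t), ramp_of_le hw (by linarith : z' ≤ t)]; simp
    · rw [ramp_of_ge hw (by linarith : t + w ≤ z), ramp_of_ge hw (by linarith : t + w ≤ z')]; simp

end Smooth

section Conc

variable {ι ν : Type} [Fintype ι] [DecidableEq ι] [Fintype ν] [DecidableEq ν]

lemma expect_abs_sgSum_le {f : (ι → Bool) → ν → Bool} {T : Finset ν} {k : ℕ}
    (h : KInd f T k) (hk : 2 ≤ k) {R : Finset ν} (hR : R ⊆ T) :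
    𝔼 x, |sgSum R (f x)| ≤ 3 * Real.sqrt R.card := by
  rcases Finset.eq_empty_or_nonempty R with rfl | hne
  · simp [sgSum]
  have hc : (0 : ℝ) < R.card := by exact_mod_cast hne.card_pos
  set r := Real.sqrt R.card with hr
  have hr0 : 0 < r := Real.sqrt_pos.2 hc
  have hr2 : r ^ 2 = R.card := Real.sq_sqrt hc.le
  have h1 : ∀ x, |sgSum R (f x)| ≤ sgSum R (f x) ^ 2 / (6 * r) + 3 / 2 * r := by
    intro x
    rw [← sq_abs, div_add' _ _ _ (by positivity), le_div_iff₀ (by positivity)]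
    nlinarith [sq_nonneg (|sgSum R (f x)| - 3 * r)]
  have h2 : 𝔼 x, sgSum R (f x) ^ 2 ≤ 8 * r ^ 2 := by
    rw [h.expect_sgSum_pow hR hk, hr2]
    have := expect_sgSum_pow_le' R (p := 1) one_ne_zero
    norm_num [Nat.factorial] at this
    exact this
  calc _ ≤ 𝔼 x, (sgSum R (f x) ^ 2 / (6 * r) + 3 / 2 * r) :=
        Finset.expect_le_expect fun x _ => h1 x
    _ = (𝔼 x, sgSum R (f x) ^ 2) / (6 * r) + 3 / 2 * r := by
      rw [Finset.expect_add_distrib, Fintype.expect_const, Finset.expect_div]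
    _ ≤ 8 * r ^ 2 / (6 * r) + 3 / 2 * r := by gcongr
    _ ≤ 3 * r := by
      rw [div_add' _ _ _ (by positivity), div_le_iff₀ (by positivity)]
      nlinarith

lemma apply_mix_eq_of_forall_notMem {f : (ι → Bool) → ν → Bool} {Nb : ι → Finset ν}
    (hNb : ∀ x j i, i ∉ Nb j → f (Function.update x j (!(x j))) i = f x i) {Q : Finset ι} {i : ν}
    (hi : ∀ j ∈ Q, i ∉ Nb j) (x y : ι → Bool) : f (mix Q x y) i = f x i := by
  induction Q using Finset.induction_on with
  | empty => rw [mix_empty]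
  | insert j Q hj ih =>
    rw [← ih fun j' hj' => hi j' (Finset.mem_insert_of_mem hj')]
    have hx : mix (insert j Q) x y = Function.update (mix Q x y) j (y j) := by
      funext l
      by_cases hl : l = j
      · subst hl; simp [mix]
      · simp [mix, hl]
    rw [hx]
    by_cases hy : y j = mix Q x y j
    · rw [hy, Function.update_eq_self]
    · have : y j = !(mix Q x y j) := by cases h1 : y j <;> cases h2 : mix Q x y j <;> simp_all
      rw [this]
      exact hNb _ _ _ (hi j (Finset.mem_insert_self _ _))

lemma abs_ones_sub_ones_le {T R : Finset ν} (hR : R ⊆ T) {u v : ν → Bool}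
    (h : ∀ i ∈ T, i ∉ R → u i = v i) :
    |(ones T u : ℝ) - ones T v| ≤ (|sgSum R u| + |sgSum R v|) / 2 := by
  have h1 : sgSum T u - sgSum R u = sgSum T v - sgSum R v := by
    unfold sgSum
    rw [← Finset.sum_sdiff hR, add_sub_cancel_right, ← Finset.sum_sdiff hR, add_sub_cancel_right]
    refine Finset.sum_congr rfl fun i hi => ?_
    rw [Finset.mem_sdiff] at hi
    rw [h i hi.1 hi.2]
  have h2 : (ones T u : ℝ) - ones T v = (sgSum R v - sgSum R u) / 2 := by
    linarith [two_mul_ones T u, two_mul_ones T v]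
  rw [h2, abs_div, abs_two]
  have := abs_sub (sgSum R v) (sgSum R u)
  linarith

lemma expect_abs_ones_mix_le {f : (ι → Bool) → ν → Bool} {T : Finset ν} {k : ℕ}
    (h : KInd f T k) (hk : 2 ≤ k) {Nb : ι → Finset ν}
    (hNb : ∀ x j i, i ∉ Nb j → f (Function.update x j (!(x j))) i = f x i) (Q : Finset ι) :
    𝔼 x, 𝔼 y, |(ones T (f x) : ℝ) - ones T (f (mix Q x y))| ≤
      3 * Real.sqrt (∑ j ∈ Q, ((Nb j).card : ℝ)) := by
  set R := T ∩ Q.biUnion Nb with hR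
  have hRT : R ⊆ T := Finset.inter_subset_left
  have h1 : 𝔼 x, 𝔼 y, |(ones T (f x) : ℝ) - ones T (f (mix Q x y))| ≤
      𝔼 x, 𝔼 y, (|sgSum R (f x)| + |sgSum R (f (mix Q x y))|) / 2 := by
    refine Finset.expect_le_expect fun x _ => Finset.expect_le_expect fun y _ => ?_
    refine abs_ones_sub_ones_le hRT fun i hi hiR => ?_
    refine (apply_mix_eq_of_forall_notMem hNb (fun j hj hij => hiR ?_) x y).symm
    rw [hR, Finset.mem_inter, Finset.mem_biUnion]
    exact ⟨hi, j, hj, hij⟩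
  have h2 : 𝔼 x, 𝔼 y, (|sgSum R (f x)| + |sgSum R (f (mix Q x y))|) / 2 =
      𝔼 x, |sgSum R (f x)| := by
    have := expect_mix Q fun x => |sgSum R (f x)|
    simp only [← Finset.expect_div, Finset.expect_add_distrib, Fintype.expect_const]
    rw [this]; ring
  rw [h2] at h1
  refine h1.trans ((expect_abs_sgSum_le h hk hRT).trans ?_)
  gcongr
  have h3 : R.card ≤ ∑ j ∈ Q, (Nb j).card :=
    (Finset.card_le_card Finset.inter_subset_right).trans Finset.card_biUnion_le
  exact_mod_cast h3

/-- `Z` is within `κ` in Kolmogorov distance of a variable with point masses at most `β`. -/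
lemma expect_ite_mem_le {α γ : Type} [Fintype α] [Fintype γ] [Nonempty α] [Nonempty γ]
    {Z : α → ℕ} {B : γ → ℕ} {κ β : ℝ}
    (hKol : ∀ s : ℤ, |𝔼 x, (if s ≤ (Z x : ℤ) then (1 : ℝ) else 0) -
      𝔼 u, (if s ≤ (B u : ℤ) then (1 : ℝ) else 0)| ≤ κ)
    (hβ : ∀ v : ℤ, 𝔼 u, (if (B u : ℤ) = v then (1 : ℝ) else 0) ≤ β)
    {a b : ℝ} (hab : a ≤ b) :
    𝔼 x, (if a ≤ (Z x : ℝ) ∧ (Z x : ℝ) ≤ b then (1 : ℝ) else 0) ≤ (b - a + 1) * β + 2 * κ := by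
  have hβ0 : 0 ≤ β := (Finset.expect_nonneg fun u _ => by split_ifs <;> norm_num).trans (hβ 0)
  have hz : ∀ z : ℕ, (a ≤ (z : ℝ) ∧ (z : ℝ) ≤ b ↔ ⌈a⌉ ≤ (z : ℤ) ∧ (z : ℤ) < ⌊b⌋ + 1) := by
    intro z
    rw [Int.lt_add_one_iff, Int.ceil_le, Int.le_floor]
    simp
  have hle : ⌈a⌉ ≤ ⌊b⌋ + 1 := by
    have : (⌈a⌉ : ℝ) < ⌊b⌋ + 2 := by
      linarith [Int.ceil_lt_add_one a, Int.lt_floor_add_one b]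
    have : ⌈a⌉ < ⌊b⌋ + 2 := by exact_mod_cast this
    omega
  have key : ∀ z : ℤ, (if ⌈a⌉ ≤ z ∧ z < ⌊b⌋ + 1 then (1 : ℝ) else 0) =
      (if ⌈a⌉ ≤ z then (1 : ℝ) else 0) - (if ⌊b⌋ + 1 ≤ z then (1 : ℝ) else 0) := by
    intro z
    split_ifs <;> first | omega | norm_num
  have hB : 𝔼 u, (if ⌈a⌉ ≤ (B u : ℤ) ∧ (B u : ℤ) < ⌊b⌋ + 1 then (1 : ℝ) else 0) ≤
      (b - a + 1) * β := by
    have h1 : ∀ z : ℤ, (if ⌈a⌉ ≤ z ∧ z < ⌊b⌋ + 1 then (1 : ℝ) else 0) =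
        ∑ v ∈ Finset.Ico ⌈a⌉ (⌊b⌋ + 1), if z = v then (1 : ℝ) else 0 := by
      intro z; rw [Finset.sum_ite_eq]; simp only [Finset.mem_Ico]
    simp only [h1]
    rw [Finset.expect_sum_comm]
    refine (Finset.sum_le_sum fun v _ => hβ v).trans ?_
    rw [Finset.sum_const, Int.card_Ico, nsmul_eq_mul]
    gcongr
    have : (((⌊b⌋ + 1 - ⌈a⌉).toNat : ℤ) : ℝ) = ⌊b⌋ + 1 - ⌈a⌉ := by
      rw [Int.toNat_of_nonneg (by omega)]; push_cast; ring
    rw [Int.cast_natCast] at this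
    rw [this]
    linarith [Int.le_ceil a, Int.floor_le b]
  simp only [hz, key, Finset.expect_sub_distrib] at hB ⊢
  have h1 := abs_le.1 (hKol ⌈a⌉)
  have h2 := abs_le.1 (hKol (⌊b⌋ + 1))
  linarith [h1.1, h1.2, h2.1, h2.2]

end Conc

section Cov

variable {ι ν : Type} [Fintype ι] [DecidableEq ι] [Fintype ν] [DecidableEq ν]

lemma abs_ramp_ones_sub_update_le {f : (ι → Bool) → ν → Bool} {T : Finset ν} {Nb : ι → Finset ν}
    (hNb : ∀ x j i, i ∉ Nb j → f (Function.update x j (!(x j))) i = f x i) {s t w : ℝ}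
    (hs : 0 < s) (hw : 0 < w) (x : ι → Bool) (j : ι) :
    |ramp t w (ones T (f x)) - ramp t w (ones T (f (Function.update x j (!(x j)))))| ≤
      s / w * (if t - s ≤ (ones T (f x) : ℝ) ∧ (ones T (f x) : ℝ) ≤ t + w + s then 1 else 0) +
      ∑ l, (sgSum (T ∩ Nb l) (f x) ^ 12 / s ^ 12 +
        sgSum (T ∩ Nb l) (f (Function.update x l (!(x l)))) ^ 12 / s ^ 12) := by
  have hpos : ∀ l, 0 ≤ sgSum (T ∩ Nb l) (f x) ^ 12 / s ^ 12 +
        sgSum (T ∩ Nb l) (f (Function.update x l (!(x l)))) ^ 12 / s ^ 12 := fun l => by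
    have h12 : Even 12 := by decide
    have := h12.pow_nonneg (sgSum (T ∩ Nb l) (f x))
    have := h12.pow_nonneg (sgSum (T ∩ Nb l) (f (Function.update x l (!(x l)))))
    positivity
  have hfst : 0 ≤ s / w * (if t - s ≤ (ones T (f x) : ℝ) ∧ (ones T (f x) : ℝ) ≤ t + w + s
      then (1 : ℝ) else 0) := by split_ifs <;> positivity
  have hbig : ∀ Y : ℝ, s < |Y| → 1 ≤ Y ^ 12 / s ^ 12 := fun Y hY => by
    rw [one_le_div (by positivity), ← Even.pow_abs (by decide : Even 12) Y]
    gcongr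
  have hone : |ramp t w (ones T (f x)) - ramp t w (ones T (f (Function.update x j (!(x j)))))| ≤
      1 := by
    rw [abs_le]
    constructor <;> linarith [ramp_nonneg t w (ones T (f x)), ramp_le_one t w (ones T (f x)),
      ramp_nonneg t w (ones T (f (Function.update x j (!(x j))))),
      ramp_le_one t w (ones T (f (Function.update x j (!(x j)))))]
  have hsum := Finset.single_le_sum (fun l _ => hpos l) (Finset.mem_univ j)
  have h12 : Even 12 := by decide
  have hp1 : 0 ≤ sgSum (T ∩ Nb j) (f x) ^ 12 / s ^ 12 :=
    div_nonneg (h12.pow_nonneg _) (by positivity)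
  have hp2 : 0 ≤ sgSum (T ∩ Nb j) (f (Function.update x j (!(x j)))) ^ 12 / s ^ 12 :=
    div_nonneg (h12.pow_nonneg _) (by positivity)
  by_cases h1 : s < |sgSum (T ∩ Nb j) (f x)|
  · linarith [hbig _ h1]
  by_cases h2 : s < |sgSum (T ∩ Nb j) (f (Function.update x j (!(x j))))|
  · linarith [hbig _ h2]
  have h3 : |(ones T (f x) : ℝ) - ones T (f (Function.update x j (!(x j))))| ≤ s := by
    refine (abs_ones_sub_ones_le (R := T ∩ Nb j) Finset.inter_subset_left
      fun i hi hiR => ?_).trans (by linarith)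
    exact (hNb x j i fun hij => hiR (Finset.mem_inter.2 ⟨hi, hij⟩)).symm
  linarith [abs_ramp_sub_le_ite (t := t) hw h3]

lemma abs_cov_ramp_le {f : (ι → Bool) → ν → Bool} {T : Finset ν} {k : ℕ}
    (h : KInd f T k) (hk : 12 ≤ k) {Nb : ι → Finset ν}
    (hNb : ∀ x j i, i ∉ Nb j → f (Function.update x j (!(x j))) i = f x i)
    {κ β : ℝ}
    (hKol : ∀ s : ℤ, |𝔼 x, (if s ≤ (ones T (f x) : ℤ) then (1 : ℝ) else 0) -
      𝔼 u, (if s ≤ (ones T u : ℤ) then (1 : ℝ) else 0)| ≤ κ)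
    (hβ : ∀ v : ℤ, 𝔼 u, (if (ones T u : ℤ) = v then (1 : ℝ) else 0) ≤ β)
    {G : (ι → Bool) → ℝ} {C c V W s t w ρ : ℝ} (hG1 : ∀ x, |G x| ≤ 1)
    (hG : ∀ Q z, ∑ j, |𝔼 u : ι → Bool, sg (u j) * G (mix Q z u)| ≤ C)
    (hs : 0 < s) (hw : 0 < w) (hV : ∑ j, ((Nb j).card : ℝ) ^ 6 ≤ V)
    (hW : ∑ j, ((Nb j).card : ℝ) ≤ W)
    (hc : C * (s / w * ((w + 2 * s + 1) * β + 2 * κ) + 8 * (Nat.factorial 12 : ℝ) * V / s ^ 12) / 2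
      ≤ c) (hc0 : 0 < c) (hρ : 0 < ρ) (hρ1 : ρ ≤ 1) :
    |(𝔼 x, G x * ramp t w (ones T (f x))) - (𝔼 x, G x) * 𝔼 x, ramp t w (ones T (f x))| ≤
      2 * c * (1 + Real.log (1 / ρ)) + 3 * Real.sqrt (2 * ρ * W) / w := by
  have hC : 0 ≤ C := (Finset.sum_nonneg fun _ _ => abs_nonneg _).trans (hG ∅ fun _ => false)
  set M : (ι → Bool) → ℝ := fun x =>
    s / w * (if t - s ≤ (ones T (f x) : ℝ) ∧ (ones T (f x) : ℝ) ≤ t + w + s then 1 else 0) +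
      ∑ l, (sgSum (T ∩ Nb l) (f x) ^ 12 / s ^ 12 +
        sgSum (T ∩ Nb l) (f (Function.update x l (!(x l)))) ^ 12 / s ^ 12) with hMdef
  have hmoment : ∀ l, 𝔼 x, sgSum (T ∩ Nb l) (f x) ^ 12 ≤
      4 * (Nat.factorial 12 : ℝ) * ((Nb l).card : ℝ) ^ 6 := fun l => by
    rw [h.expect_sgSum_pow Finset.inter_subset_left hk]
    refine (expect_sgSum_pow_le' (T ∩ Nb l) (p := 6) (by norm_num)).trans ?_
    have : ((T ∩ Nb l).card : ℝ) ≤ (Nb l).card := by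
      exact_mod_cast Finset.card_le_card Finset.inter_subset_right
    gcongr
  have hEM : 𝔼 x, M x ≤ s / w * ((w + 2 * s + 1) * β + 2 * κ) +
      8 * (Nat.factorial 12 : ℝ) * V / s ^ 12 := by
    simp only [hMdef, Finset.expect_add_distrib, ← Finset.mul_expect, Finset.expect_sum_comm]
    refine add_le_add (mul_le_mul_of_nonneg_left ?_ (by positivity)) ?_
    · have := expect_ite_mem_le hKol hβ (a := t - s) (b := t + w + s) (by linarith)
      refine this.trans (le_of_eq ?_)
      ring
    · have h2 : ∀ l ∈ Finset.univ, (𝔼 x, sgSum (T ∩ Nb l) (f x) ^ 12 / s ^ 12 +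
          𝔼 x, sgSum (T ∩ Nb l) (f (Function.update x l (!(x l)))) ^ 12 / s ^ 12) ≤
          8 * (Nat.factorial 12 : ℝ) / s ^ 12 * ((Nb l).card : ℝ) ^ 6 := by
        intro l _
        rw [expect_flip (fun x => sgSum (T ∩ Nb l) (f x) ^ 12 / s ^ 12) l, ← Finset.expect_div,
          ← add_div, div_mul_eq_mul_div]
        gcongr
        linarith [hmoment l]
      refine (Finset.sum_le_sum h2).trans ?_
      rw [← Finset.mul_sum]
      exact (mul_le_mul_of_nonneg_left hV (by positivity)).trans (le_of_eq (by ring))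
  refine abs_cov_le (h := fun x => ramp t w (ones T (f x))) (M := M) hG1 hG
    (fun x j => abs_ramp_ones_sub_update_le hNb hs hw x j) (fun x => ?_)
    (le_trans ?_ hc) hc0 (fun j => ((Nb j).card : ℝ)) (fun j => Nat.cast_nonneg _) hρ hρ1
    fun Q hQ => ?_
  · refine add_nonneg (by split_ifs <;> positivity) (Finset.sum_nonneg fun l _ => ?_)
    have h12 : Even 12 := by decide
    exact add_nonneg (div_nonneg (h12.pow_nonneg _) (by positivity))
      (div_nonneg (h12.pow_nonneg _) (by positivity))
  · gcongr
  · have h1 : 𝔼 x, 𝔼 y, |ramp t w (ones T (f x)) - ramp t w (ones T (f (mix Q x y)))| ≤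
        (𝔼 x, 𝔼 y, |(ones T (f x) : ℝ) - ones T (f (mix Q x y))|) / w := by
      simp only [Finset.expect_div]
      exact Finset.expect_le_expect fun x _ => Finset.expect_le_expect fun y _ =>
        abs_ramp_sub_le hw _ _
    refine h1.trans ?_
    gcongr
    refine (expect_abs_ones_mix_le h (by omega) hNb Q).trans ?_
    have : 2 * ρ * ∑ j, ((Nb j).card : ℝ) ≤ 2 * ρ * W := by gcongr
    gcongr
    exact hQ.trans this

lemma ones_univ_le (T : Finset ν) (u : ν → Bool) :
    ones Finset.univ u ≤ ones T u + (Fintype.card ν - T.card) := by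
  unfold ones
  rw [← Finset.card_compl, ← Finset.union_compl T, Finset.filter_union]
  exact (Finset.card_union_le _ _).trans (Nat.add_le_add_left (Finset.card_filter_le _ _) _)

lemma ones_mono {T T' : Finset ν} (h : T ⊆ T') (u : ν → Bool) : ones T u ≤ ones T' u :=
  Finset.card_le_card (Finset.filter_subset_filter _ h)

lemma abs_expect_mul_sub_le {α : Type} [Fintype α] {G p q r : α → ℝ} (hG : ∀ x, |G x| ≤ 1)
    (h : ∀ x, |p x - q x| ≤ r x) : |(𝔼 x, G x * p x) - 𝔼 x, G x * q x| ≤ 𝔼 x, r x := by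
  rw [← Finset.expect_sub_distrib]
  refine (Finset.abs_expect_le _ _).trans (Finset.expect_le_expect fun x _ => ?_)
  rw [← mul_sub, abs_mul]
  exact (mul_le_of_le_one_left (abs_nonneg _) (hG x)).trans (h x)

lemma abs_expect_sub_le {α : Type} [Fintype α] {p q r : α → ℝ}
    (h : ∀ x, |p x - q x| ≤ r x) : |(𝔼 x, p x) - 𝔼 x, q x| ≤ 𝔼 x, r x := by
  simpa using abs_expect_mul_sub_le (G := fun _ => 1) (by simp) h

/-- The tail of the weight of `f`, and its correlation with a function `G` of small total
influence, compared with the tail of a uniform string. -/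
lemma tail_bounds {f : (ι → Bool) → ν → Bool} {T : Finset ν}
    {κ β : ℝ}
    (hKol : ∀ s : ℤ, |𝔼 x, (if s ≤ (ones T (f x) : ℤ) then (1 : ℝ) else 0) -
      𝔼 u, (if s ≤ (ones T u : ℤ) then (1 : ℝ) else 0)| ≤ κ)
    (hβ : ∀ v : ℤ, 𝔼 u, (if (ones T u : ℤ) = v then (1 : ℝ) else 0) ≤ β)
    {G : (ι → Bool) → ℝ} (hG1 : ∀ x, |G x| ≤ 1) {t w r E W : ℝ} (hw : 0 < w)
    (hr : ((Fintype.card ν - T.card : ℕ) : ℝ) ≤ r)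
    (hE : |(𝔼 x, G x * ramp t w (ones T (f x))) - (𝔼 x, G x) * 𝔼 x, ramp t w (ones T (f x))| ≤ E)
    (hW : (w + r + 1) * β + 2 * κ ≤ W) :
    |𝔼 x, (if t < (ones Finset.univ (f x) : ℝ) then (1 : ℝ) else 0) -
      𝔼 u : ν → Bool, (if t < (ones Finset.univ u : ℝ) then (1 : ℝ) else 0)| ≤ 3 * W ∧
    |𝔼 x, G x * (if t < (ones Finset.univ (f x) : ℝ) then (1 : ℝ) else 0) -
      (𝔼 x, G x) * 𝔼 u : ν → Bool, (if t < (ones Finset.univ u : ℝ) then (1 : ℝ) else 0)| ≤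
      5 * W + E := by
  have hβ0 : 0 ≤ β := (Finset.expect_nonneg fun u _ => by split_ifs <;> norm_num).trans (hβ 0)
  have hκ0 : 0 ≤ κ := (abs_nonneg _).trans (hKol 0)
  have hr0 : 0 ≤ r := (Nat.cast_nonneg _).trans hr
  have hlow : ∀ u : ν → Bool, (ones T u : ℝ) ≤ ones Finset.univ u := fun u => by
    exact_mod_cast ones_mono (Finset.subset_univ _) u
  have hup : ∀ u : ν → Bool, (ones Finset.univ u : ℝ) ≤ ones T u + r := fun u => by
    have : (ones Finset.univ u : ℝ) ≤ ones T u + (Fintype.card ν - T.card : ℕ) := by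
      exact_mod_cast ones_univ_le T u
    linarith
  set I : (ν → Bool) → ℝ := fun u => if t < (ones Finset.univ u : ℝ) then 1 else 0 with hI
  set J : (ν → Bool) → ℝ := fun u => if t < (ones T u : ℝ) then 1 else 0 with hJ
  set R : (ν → Bool) → ℝ := fun u =>
    if t - r ≤ (ones T u : ℝ) ∧ (ones T u : ℝ) ≤ t + w then 1 else 0 with hR
  have hIJ : ∀ u, |I u - J u| ≤ R u := fun u => by
    have h1 := hlow u
    have h2 := hup u
    simp only [hI, hJ, hR]
    by_cases h3 : t < (ones T u : ℝ)
    · rw [if_pos h3, if_pos (by linarith)]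
      split_ifs <;> norm_num
    · rw [if_neg h3]
      by_cases h4 : t < (ones Finset.univ u : ℝ)
      · rw [if_pos h4, if_pos ⟨by linarith, by linarith⟩]; norm_num
      · rw [if_neg h4]
        split_ifs <;> norm_num
  have hIr : ∀ u, |I u - ramp t w (ones T u)| ≤ R u := fun u => by
    have h1 := hlow u
    have h2 := hup u
    simp only [hI, hR]
    by_cases h4 : t < (ones Finset.univ u : ℝ)
    · rw [if_pos h4]
      by_cases h5 : t + w ≤ (ones T u : ℝ)
      · rw [ramp_of_ge hw h5]
        split_ifs <;> norm_num
      · rw [if_pos ⟨by linarith, by linarith⟩, abs_le]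
        constructor <;> linarith [ramp_nonneg t w (ones T u), ramp_le_one t w (ones T u)]
    · rw [if_neg h4, ramp_of_le hw (by linarith)]
      split_ifs <;> norm_num
  have hwin : 𝔼 x, R (f x) ≤ W := by
    refine (expect_ite_mem_le hKol hβ (a := t - r) (b := t + w) (by linarith)).trans ?_
    refine le_trans (le_of_eq ?_) hW
    ring
  have hwin' : 𝔼 u, R u ≤ W := by
    have := expect_ite_mem_le (Z := fun u => ones T u) (B := fun u => ones T u) (κ := 0)
      (by simp) hβ (a := t - r) (b := t + w) (by linarith)
    refine this.trans (le_trans ?_ hW)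
    linarith
  have hJK : |(𝔼 x, J (f x)) - 𝔼 u, J u| ≤ W := by
    have h1 := hKol (⌊t⌋ + 1)
    have h2 : ∀ u : ν → Bool, (⌊t⌋ + 1 ≤ (ones T u : ℤ) ↔ t < (ones T u : ℝ)) := fun u => by
      rw [Int.add_one_le_iff, Int.floor_lt]; simp
    simp only [h2] at h1
    refine h1.trans (le_trans ?_ hW)
    have : 0 ≤ (w + r + 1) * β := by positivity
    linarith
  have hA : |(𝔼 x, I (f x)) - 𝔼 u, I u| ≤ 3 * W := by
    have h1 := abs_expect_sub_le fun x => hIJ (f x)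
    have h2 := abs_expect_sub_le hIJ
    rw [abs_le] at *
    constructor <;> linarith [h1.1, h1.2, h2.1, h2.2, hJK.1, hJK.2]
  refine ⟨hA, ?_⟩
  have hg : |𝔼 x, G x| ≤ 1 := by
    refine (Finset.abs_expect_le _ _).trans ?_
    calc _ ≤ 𝔼 _x : ι → Bool, (1 : ℝ) := Finset.expect_le_expect fun x _ => hG1 x
      _ = 1 := Fintype.expect_const _
  have h1 := abs_expect_mul_sub_le hG1 fun x => hIr (f x)
  have h2 := abs_expect_sub_le fun x => hIr (f x)
  have h3 : |(𝔼 x, G x) * (𝔼 x, ramp t w (ones T (f x)) - 𝔼 u, I u)| ≤ 4 * W := by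
    rw [abs_mul]
    refine (mul_le_of_le_one_left (abs_nonneg _) hg).trans ?_
    rw [abs_le] at *
    constructor <;> linarith [h2.1, h2.2, hA.1, hA.2]
  rw [mul_sub] at h3
  rw [abs_le] at *
  constructor <;> linarith [h1.1, h1.2, h3.1, h3.2, hE.1, hE.2]

end Cov

lemma exists_cutoff_params (d : ℕ) {C : ℝ} (hC : 1 ≤ C) : ∃ K : ℕ, ∀ δ A : ℝ, 0 < δ → δ ≤ 1 / 16 →
    32 ≤ A → ∃ B σ : ℝ, 32 ≤ B ∧ B ≤ A ∧ 1 ≤ σ ∧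
      σ / √B ≤ Real.log (1 / δ) ^ K / √(A * δ) + δ ∧
      C * (8 * (σ / √B) + 8 * (Nat.factorial 12 : ℝ) * d * B / σ ^ 12) *
        (1 + Real.log (18 * d / δ ^ 4)) ≤ 2 * (Real.log (1 / δ) ^ K / √(A * δ) + δ) := by
  set M : ℝ := C * (5 + 18 * d) with hM
  have hM1 : 1 ≤ M := by rw [hM]; nlinarith [(Nat.cast_nonneg d : (0 : ℝ) ≤ d)]
  set D : ℝ := M * (8 * (Nat.factorial 12 : ℝ) * d) with hD
  have hD0 : 0 ≤ D := by positivity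
  obtain ⟨q, hq⟩ := pow_unbounded_of_one_lt (8 * M + D) (one_lt_two (α := ℝ))
  have hq1 : 1 ≤ q := by
    rcases Nat.eq_zero_or_pos q with h | h
    · rw [h, pow_zero] at hq; linarith
    · exact h
  refine ⟨4 * q, fun δ A hδ hδ1 hA => ?_⟩
  set L := Real.log (1 / δ) with hL
  have hL2 : 2 ≤ L := by
    have h16 : Real.log 16 ≤ L := Real.log_le_log (by norm_num) (by
      rw [le_div_iff₀ hδ]; linarith)
    have : Real.log 16 = 4 * Real.log 2 := by
      rw [show (16 : ℝ) = 2 ^ 4 by norm_num, Real.log_pow]; norm_num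
    linarith [Real.log_two_gt_d9]
  have hL1 : 1 ≤ L := by linarith
  have hL0 : 0 < L := by linarith
  have hLq : 8 * M + D ≤ L ^ q := hq.le.trans (pow_le_pow_left₀ (by norm_num) hL2 q)
  set B := min A (L ^ (8 * q) / δ ^ 3) with hB
  have hBbig : 32 ≤ L ^ (8 * q) / δ ^ 3 := by
    rw [le_div_iff₀ (by positivity)]
    have : δ ^ 3 ≤ (1 / 16) ^ 3 := pow_le_pow_left₀ hδ.le hδ1 3
    have := one_le_pow₀ hL1 (n := 8 * q)
    linarith
  have hB32 : 32 ≤ B := le_min hA hBbig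
  have hB0 : 0 < B := by linarith
  have hBδ : 0 < √(B * δ) := Real.sqrt_pos.2 (by positivity)
  have hmain : L ^ (4 * q) / √(B * δ) ≤ L ^ (4 * q) / √(A * δ) + δ := by
    rcases le_total A (L ^ (8 * q) / δ ^ 3) with h | h
    · rw [hB, min_eq_left h]; linarith
    · rw [hB, min_eq_right h]
      have h1 : L ^ (8 * q) / δ ^ 3 * δ = (L ^ (4 * q) / δ) ^ 2 := by
        field_simp; ring
      rw [h1, Real.sqrt_sq (by positivity)]
      have h2 : L ^ (4 * q) / (L ^ (4 * q) / δ) = δ := by field_simp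
      rw [h2]
      have : 0 ≤ L ^ (4 * q) / √(A * δ) := by positivity
      linarith
  have hsδ : 0 < √δ := Real.sqrt_pos.2 hδ
  have hσB : L ^ q / √δ / √B = L ^ q / √(B * δ) := by
    rw [Real.sqrt_mul hB0.le, div_div, mul_comm √δ]
  refine ⟨B, L ^ q / √δ, hB32, min_le_left _ _, ?_, ?_, ?_⟩
  · rw [one_le_div hsδ]
    exact (Real.sqrt_le_one.2 (by linarith)).trans (one_le_pow₀ hL1)
  · rw [hσB]
    refine le_trans ?_ hmain
    gcongr
    omega
  · have hlog : 1 + Real.log (18 * d / δ ^ 4) ≤ (5 + 18 * d) * L := by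
      have h1 : Real.log (18 * d / δ ^ 4) ≤ 18 * d + 4 * L := by
        rcases Nat.eq_zero_or_pos d with h | h
        · simp only [h, Nat.cast_zero, mul_zero, zero_div, Real.log_zero]; linarith
        · have hd : (0 : ℝ) < d := by exact_mod_cast h
          rw [Real.log_div (by positivity) (by positivity), Real.log_pow, hL, one_div,
            Real.log_inv]
          have := Real.log_le_sub_one_of_pos (show (0 : ℝ) < 18 * d by positivity)
          push_cast
          linarith
      nlinarith [(Nat.cast_nonneg d : (0 : ℝ) ≤ d)]
    have hpos : 0 ≤ C * (8 * (L ^ q / √δ / √B) +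
        8 * (Nat.factorial 12 : ℝ) * d * B / (L ^ q / √δ) ^ 12) := by positivity
    refine (mul_le_mul_of_nonneg_left hlog hpos).trans ?_
    have h1 : M * L * (8 * (L ^ q / √δ / √B)) ≤ L ^ (4 * q) / √(A * δ) + δ := by
      rw [hσB]
      refine le_trans ?_ hmain
      rw [mul_div_assoc', mul_div_assoc']
      refine div_le_div_of_nonneg_right ?_ hBδ.le
      calc M * L * (8 * L ^ q) = 8 * M * (L ^ 1 * L ^ q) := by ring
        _ ≤ L ^ q * (L ^ q * L ^ q) := by
          gcongr
          · linarith
        _ ≤ L ^ (4 * q) := by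
          rw [← pow_add, ← pow_add]
          exact pow_le_pow_right₀ hL1 (by omega)
    have h2 : M * L * (8 * (Nat.factorial 12 : ℝ) * d * B / (L ^ q / √δ) ^ 12) ≤ δ := by
      have hs12 : √δ ^ 12 = δ ^ 6 := by
        rw [show 12 = 2 * 6 by norm_num, pow_mul, Real.sq_sqrt hδ.le]
      rw [div_pow, hs12]
      have hBle : B ≤ L ^ (8 * q) / δ ^ 3 := min_le_right _ _
      calc M * L * (8 * (Nat.factorial 12 : ℝ) * d * B / ((L ^ q) ^ 12 / δ ^ 6))
          = D * L * δ ^ 6 / (L ^ q) ^ 12 * B := by rw [hD]; field_simp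
        _ ≤ D * L * δ ^ 6 / (L ^ q) ^ 12 * (L ^ (8 * q) / δ ^ 3) := by gcongr
        _ = (D * L / L ^ (4 * q)) * δ ^ 3 := by
          rw [show (L ^ q) ^ 12 = L ^ (8 * q) * L ^ (4 * q) by rw [← pow_mul, ← pow_add]; ring_nf]
          field_simp
        _ ≤ 1 * δ ^ 1 := by
          refine mul_le_mul ?_ ?_ (by positivity) (by norm_num)
          · rw [div_le_one (by positivity)]
            calc D * L ≤ L ^ q * L ^ q := by
                  gcongr
                  · linarith
                  · calc L = L ^ 1 := (pow_one _).symm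
                      _ ≤ L ^ q := pow_le_pow_right₀ hL1 hq1
              _ ≤ L ^ (4 * q) := by
                  rw [← pow_add]; exact pow_le_pow_right₀ hL1 (by omega)
          · exact pow_le_pow_of_le_one hδ.le (by linarith) (by norm_num)
        _ = δ := by ring
    calc _ = M * L * (8 * (L ^ q / √δ / √B)) +
          M * L * (8 * (Nat.factorial 12 : ℝ) * d * B / (L ^ q / √δ) ^ 12) := by rw [hM]; ring
      _ ≤ _ := by
          have : 0 ≤ L ^ (4 * q) / √(A * δ) := by positivity
          linarith

section Core

variable {ι ν : Type} [Fintype ι] [DecidableEq ι] [Fintype ν] [DecidableEq ν]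

lemma tail_bounds_of_params {f : (ι → Bool) → ν → Bool} {T : Finset ν} {k d : ℕ}
    (h : KInd f T k) (hk : 12 ≤ k) (hd : 1 ≤ d) {Nb : ι → Finset ν}
    (hNb : ∀ x j i, i ∉ Nb j → f (Function.update x j (!(x j))) i = f x i)
    {κ : ℝ}
    (hKol : ∀ s : ℤ, |𝔼 x, (if s ≤ (ones T (f x) : ℤ) then (1 : ℝ) else 0) -
      𝔼 u, (if s ≤ (ones T u : ℤ) then (1 : ℝ) else 0)| ≤ κ)
    {G : (ι → Bool) → ℝ} {C B σ δ : ℝ} (hG1 : ∀ x, |G x| ≤ 1) (hC : 1 ≤ C)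
    (hG : ∀ Q z, ∑ j, |𝔼 u : ι → Bool, sg (u j) * G (mix Q z u)| ≤ C)
    (hB : 0 < B) (hBn : B ≤ Fintype.card ν) (hσ : 1 ≤ σ) (hδ : 0 < δ) (hδ1 : δ ≤ 1)
    (hdeg : ∀ j, ((Nb j).card : ℝ) ≤ Fintype.card ν / B)
    (hsum : ∑ j, ((Nb j).card : ℝ) ≤ d * Fintype.card ν)
    (hT : ((Fintype.card ν - T.card : ℕ) : ℝ) ≤ √(Fintype.card ν / B))
    (hT2 : (Fintype.card ν : ℝ) / 2 ≤ T.card) (t : ℝ) {E : ℝ}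
    (hE : C * (8 * (σ / √B) + 8 * (Nat.factorial 12 : ℝ) * d * B / σ ^ 12) *
        (1 + Real.log (18 * d / δ ^ 4)) ≤ E) :
    |𝔼 x, (if t < (ones Finset.univ (f x) : ℝ) then (1 : ℝ) else 0) -
      𝔼 u : ν → Bool, (if t < (ones Finset.univ u : ℝ) then (1 : ℝ) else 0)| ≤
      3 * (5 * (δ + κ + σ / √B)) ∧
    |𝔼 x, G x * (if t < (ones Finset.univ (f x) : ℝ) then (1 : ℝ) else 0) -
      (𝔼 x, G x) * 𝔼 u : ν → Bool, (if t < (ones Finset.univ u : ℝ) then (1 : ℝ) else 0)| ≤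
      5 * (5 * (δ + κ + σ / √B)) + (E + δ) := by
  set n : ℝ := (Fintype.card ν : ℝ) with hn
  have hn0 : 0 < n := by linarith
  have hκ : 0 ≤ κ := (abs_nonneg _).trans (hKol 0)
  have hd0 : (0 : ℝ) < d := by exact_mod_cast hd
  have hd1 : (1 : ℝ) ≤ d := by exact_mod_cast hd
  have hsB : 0 < √B := Real.sqrt_pos.2 hB
  have hsn : 0 < √n := Real.sqrt_pos.2 hn0
  have hT0 : (0 : ℝ) < T.card := by linarith
  set x := σ / √B with hx
  have hx0 : 0 < x := by positivity
  have hax : 1 / √B ≤ x := by rw [hx]; gcongr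
  have han : 1 / √n ≤ 1 / √B := one_div_le_one_div_of_le hsB (Real.sqrt_le_sqrt hBn)
  set l := δ + κ + x with hl
  have hl0 : 0 < l := by positivity
  have hβ : ∀ v : ℤ, 𝔼 u, (if (ones T u : ℤ) = v then (1 : ℝ) else 0) ≤ 3 / 2 / √n := fun v => by
    refine (expect_ones_eq_le (by rintro h0; simp [h0] at hT0) v).trans ?_
    rw [div_le_div_iff₀ (Real.sqrt_pos.2 hT0) hsn, one_mul]
    refine Real.sqrt_le_iff.2 ⟨by positivity, ?_⟩
    rw [mul_pow, Real.sq_sqrt hT0.le]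
    linarith
  have hsqn : √n * √n = n := Real.mul_self_sqrt hn0.le
  have hc0 : 0 < C * (8 * x + 8 * (Nat.factorial 12 : ℝ) * d * B / σ ^ 12) / 2 := by positivity
  have hV : ∑ j, ((Nb j).card : ℝ) ^ 6 ≤ (n / B) ^ 5 * (d * n) := by
    calc ∑ j, ((Nb j).card : ℝ) ^ 6 ≤ ∑ j, (n / B) ^ 5 * ((Nb j).card : ℝ) := by
          refine Finset.sum_le_sum fun j _ => ?_
          rw [pow_succ]
          gcongr
          exact hdeg j
      _ = (n / B) ^ 5 * ∑ j, ((Nb j).card : ℝ) := by rw [Finset.mul_sum]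
      _ ≤ _ := by gcongr
  have hβ1 : ∀ y : ℝ, (y * √n + 1) * (3 / 2 / √n) = 3 / 2 * (y + 1 / √n) := fun y => by
    field_simp
  have key : |(𝔼 x, G x * ramp t (l * √n) (ones T (f x))) -
      (𝔼 x, G x) * 𝔼 x, ramp t (l * √n) (ones T (f x))| ≤ E + δ := by
    have hρ1 : δ ^ 4 / (18 * d) ≤ 1 := by
      rw [div_le_one (by positivity)]
      have : δ ^ 4 ≤ 1 := pow_le_one₀ hδ.le hδ1
      linarith
    refine (abs_cov_ramp_le (s := x * √n) (ρ := δ ^ 4 / (18 * d)) h hk hNb hKol hβ hG1 hG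
      (by positivity) (by positivity) hV hsum ?_ hc0 (by positivity) hρ1).trans ?_
    · gcongr ?_ / 2
      refine mul_le_mul_of_nonneg_left (add_le_add ?_ (le_of_eq ?_)) (by linarith)
      · have h1 : l * √n + 2 * (x * √n) + 1 = (l + 2 * x) * √n + 1 := by ring
        rw [h1, hβ1]
        have h2 : x * √n / (l * √n) = x / l := by field_simp
        rw [h2, div_mul_eq_mul_div, div_le_iff₀ hl0]
        have : 3 / 2 * (l + 2 * x + 1 / √n) + 2 * κ ≤ 8 * l := by linarith
        nlinarith
      · have h2 : (x * √n) ^ 12 = σ ^ 12 * n ^ 6 / B ^ 6 := by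
          rw [hx, mul_pow, div_pow, show 12 = 2 * 6 by norm_num, pow_mul √B, pow_mul √n,
            Real.sq_sqrt hB.le, Real.sq_sqrt hn0.le]
          ring
        rw [h2]
        field_simp
    · refine add_le_add ?_ ?_
      · rw [one_div_div]
        refine le_trans (le_of_eq ?_) hE
        ring
      · have h1 : 2 * (δ ^ 4 / (18 * d)) * (d * n) = (δ ^ 2 / 3) ^ 2 * n := by field_simp; ring
        rw [h1, Real.sqrt_mul (by positivity), Real.sqrt_sq (by positivity),
          div_le_iff₀ (by positivity)]
        have : δ ^ 2 * √n ≤ δ * l * √n := by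
          gcongr
          nlinarith
        linarith
  refine tail_bounds hKol hβ hG1 (w := l * √n) (r := √(n / B)) (by positivity) hT key ?_
  have h1 : √(n / B) = 1 / √B * √n := by rw [Real.sqrt_div hn0.le]; ring
  rw [h1, ← add_mul, hβ1]
  linarith

end Core

section Main

lemma KInd.exists_kolmogorov_le {ι ν : Type} [Fintype ι] [DecidableEq ι] [Fintype ν]
    [DecidableEq ν] {f : (ι → Bool) → ν → Bool} {T : Finset ν} {k : ℕ} (h : KInd f T k)
    (hk : 12 ≤ k) (hT : 12 ≤ T.card) :
    ∃ k', 12 ≤ k' ∧ KInd f T k' ∧ ∀ s : ℤ,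
      |𝔼 x, (if s ≤ (ones T (f x) : ℤ) then (1 : ℝ) else 0) -
        𝔼 u, (if s ≤ (ones T u : ℤ) then (1 : ℝ) else 0)| ≤ 250 * (1 / √k + 1 / √T.card) := by
  set l := min k T.card with hl
  have hl12 : 12 ≤ l := le_min hk hT
  set k' := 2 * (l / 2) with hk'
  have hkl : k' ≤ l := by omega
  have hlk : l ≤ k' + 1 := by omega
  have h12 : 12 ≤ k' := by omega
  have hK : KInd f T k' := h.mono (hkl.trans (min_le_left _ _))
  refine ⟨k', h12, hK, fun s => ?_⟩
  refine (hK.abs_expect_le_ones_sub_le (even_two_mul _) (by omega)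
    (hkl.trans (min_le_right _ _)) s).trans ?_
  have hl0 : (0 : ℝ) < l := by exact_mod_cast (by omega : 0 < l)
  have hk0 : (0 : ℝ) < k' := by exact_mod_cast (by omega : 0 < k')
  have h1 : 200 / √k' ≤ 250 * (1 / √l) := by
    rw [mul_one_div, div_le_div_iff₀ (Real.sqrt_pos.2 hk0) (Real.sqrt_pos.2 hl0)]
    have : √l ≤ 5 / 4 * √k' := by
      refine Real.sqrt_le_iff.2 ⟨by positivity, ?_⟩
      rw [mul_pow, Real.sq_sqrt hk0.le]
      have h2 : (l : ℝ) ≤ k' + 1 := by exact_mod_cast hlk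
      have h3 : (12 : ℝ) ≤ k' := by exact_mod_cast h12
      linarith
    linarith
  refine h1.trans (mul_le_mul_of_nonneg_left ?_ (by norm_num))
  have ha : 0 ≤ 1 / √(k : ℝ) := by positivity
  have hb : 0 ≤ 1 / √(T.card : ℝ) := by positivity
  rcases min_choice k T.card with h2 | h2 <;> rw [hl, h2] <;> linarith

lemma exists_local_tail_bounds {d : ℕ} (hd : 1 ≤ d) : ∃ K : ℕ, ∀ (ι ν : Type) [Fintype ι]
    [DecidableEq ι] [Fintype ν] [DecidableEq ν] (f : (ι → Bool) → ν → Bool) (T : Finset ν)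
    (k : ℕ) (Nb : ι → Finset ν) (G : (ι → Bool) → ℝ) (A δ t : ℝ), KInd f T k → 12 ≤ k →
    (∀ x j i, i ∉ Nb j → f (Function.update x j (!(x j))) i = f x i) → PhaseDeg d G →
    32 ≤ A → A ≤ Fintype.card ν → (∀ j, ((Nb j).card : ℝ) ≤ Fintype.card ν / A) →
    ∑ j, ((Nb j).card : ℝ) ≤ d * Fintype.card ν →
    ((Fintype.card ν - T.card : ℕ) : ℝ) ≤ √(Fintype.card ν / A) →
    0 < δ → δ ≤ 1 / 16 →
    |𝔼 x, (if t < (ones Finset.univ (f x) : ℝ) then (1 : ℝ) else 0) -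
      𝔼 u : ν → Bool, (if t < (ones Finset.univ u : ℝ) then (1 : ℝ) else 0)| ≤
      20000 * (Real.log (1 / δ) ^ K / √(A * δ) + Real.log k / √k + δ) ∧
    |𝔼 x, G x * (if t < (ones Finset.univ (f x) : ℝ) then (1 : ℝ) else 0) -
      (𝔼 x, G x) * 𝔼 u : ν → Bool, (if t < (ones Finset.univ u : ℝ) then (1 : ℝ) else 0)| ≤
      20000 * (Real.log (1 / δ) ^ K / √(A * δ) + Real.log k / √k + δ) := by
  obtain ⟨C₀, -, hC₀⟩ := PhaseDeg.exists_sum_abs_le d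
  obtain ⟨K, hK⟩ := exists_cutoff_params d (le_max_right C₀ 1)
  refine ⟨K, fun ι ν _ _ _ _ f T k Nb G A δ t hf hk hNb hG hA hAn hdeg hsum hT hδ hδ1 => ?_⟩
  obtain ⟨B, σ, hB, hBA, hσ, hσB, hE⟩ := hK δ A hδ hδ1 hA
  set n : ℝ := (Fintype.card ν : ℝ) with hn
  have hn0 : 0 < n := by linarith
  have hTc : ((Fintype.card ν - T.card : ℕ) : ℝ) = n - T.card := by
    rw [Nat.cast_sub (Finset.card_le_univ T)]
  have hT2 : n / 2 ≤ T.card := by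
    have : √(n / A) ≤ n / 2 := by
      refine Real.sqrt_le_iff.2 ⟨by positivity, ?_⟩
      calc n / A ≤ n / 1 := by gcongr; linarith
        _ ≤ (n / 2) ^ 2 := by nlinarith
    linarith
  have hT12 : 12 ≤ T.card := by
    have : (12 : ℝ) ≤ T.card := by linarith
    exact_mod_cast this
  obtain ⟨k', hk', hfk', hKol⟩ := hf.exists_kolmogorov_le hk hT12
  have hB0 : 0 < B := by linarith
  have hdegB : n / A ≤ n / B := by gcongr
  have hG1 : ∀ x, |G x| ≤ 1 := fun x => (hG.abs_eq x).le
  obtain ⟨h1, h2⟩ := tail_bounds_of_params hfk' hk' hd hNb hKol hG1 (le_max_right C₀ 1)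
    (fun Q z => (hC₀ ι _ (hG.comp_mix Q z)).trans (le_max_left _ _)) hB0 (hBA.trans hAn) hσ hδ
    (by linarith) (fun j => (hdeg j).trans hdegB) hsum (hT.trans (Real.sqrt_le_sqrt hdegB)) hT2 t hE
  have hL1 : 1 ≤ Real.log (1 / δ) := by
    rw [Real.le_log_iff_exp_le (by positivity), le_div_iff₀ hδ]
    nlinarith [Real.exp_one_lt_d9]
  have hP : 1 / √A ≤ Real.log (1 / δ) ^ K / √(A * δ) := by
    have : 0 < A * δ := by positivity
    gcongr
    · exact one_le_pow₀ hL1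
    · nlinarith
  have hTA : 1 / √T.card ≤ 3 / 2 * (1 / √A) := by
    have hT0 : (0 : ℝ) < T.card := by linarith
    have hA0 : 0 < A := by linarith
    rw [mul_one_div, div_le_div_iff₀ (Real.sqrt_pos.2 hT0) (Real.sqrt_pos.2 hA0), one_mul]
    refine Real.sqrt_le_iff.2 ⟨by positivity, ?_⟩
    rw [mul_pow, Real.sq_sqrt hT0.le]
    linarith
  have hkl : 1 / √(k : ℝ) ≤ 8 / 5 * (Real.log k / √k) := by
    rw [mul_div_assoc']
    gcongr
    have : Real.log 2 ≤ Real.log k := Real.log_le_log (by norm_num) (by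
      exact_mod_cast (by omega : 2 ≤ k))
    linarith [Real.log_two_gt_d9]
  have hk0 : 0 ≤ 1 / √(k : ℝ) := by positivity
  have hP0 : 0 ≤ 1 / √A := by positivity
  constructor <;> linarith

end Main

section Translation

lemma sum_filter_pushf_unifOn {α β : Type} [Fintype α] [DecidableEq α] [Nonempty α] [Fintype β]
    [DecidableEq β] (f : α → β) (p : β → Prop) [DecidablePred p] :
    ∑ y ∈ Finset.univ.filter p, pushf f (unifOn (Finset.univ : Finset α)) y =
      𝔼 x, if p (f x) then (1 : ℝ) else 0 := by
  have h : ∀ y, pushf f (unifOn (Finset.univ : Finset α)) y =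
      ∑ x, if f x = y then (Fintype.card α : ℝ)⁻¹ else 0 := fun y => by
    simp [pushf, unifOn, Finset.sum_ite]
  simp only [h]
  rw [Finset.sum_filter, Finset.expect_eq_sum_div_card, Finset.sum_div]
  simp only [← Finset.sum_filter (s := Finset.univ) (p := p)]
  rw [Finset.sum_comm]
  refine Finset.sum_congr rfl fun x _ => ?_
  rw [Finset.sum_ite_eq]
  simp only [Finset.mem_filter, Finset.mem_univ, true_and, Finset.card_univ]
  split_ifs <;> simp

lemma card_filter_div_two_pow {n : ℕ} (p : (Fin n → Bool) → Prop) [DecidablePred p] :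
    ((Finset.univ.filter p).card : ℝ) / 2 ^ n = 𝔼 y, if p y then (1 : ℝ) else 0 := by
  rw [Finset.expect_eq_sum_div_card, Finset.sum_boole]
  simp

lemma prod_sg_eq {n : ℕ} (y : Fin n → Bool) : ∏ i, sg (y i) = (-1) ^ hw y := by
  unfold hw sg
  rw [Finset.prod_ite]
  simp

lemma eq_of_forall_not_affects {m n : ℕ} {f : (Fin m → Bool) → Fin n → Bool} {i : Fin n}
    (h : ∀ j, ¬ Affects f j i) (x y : Fin m → Bool) : f x i = f y i := by
  suffices H : ∀ (s : Finset (Fin m)) (x : Fin m → Bool), (∀ j, j ∉ s → x j = y j) →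
      f x i = f y i from H Finset.univ x fun j hj => absurd (Finset.mem_univ j) hj
  intro s
  induction s using Finset.induction_on with
  | empty => exact fun x hx => by rw [funext fun j => hx j (Finset.notMem_empty j)]
  | insert a s _ ih =>
    intro x hx
    have ha : f x i = f (Function.update x a (!(x a))) i := by
      by_contra hne
      exact h a ⟨x, hne⟩
    by_cases hxa : x a = y a
    · refine ih x fun j hj => ?_
      rcases eq_or_ne j a with rfl | hja
      · exact hxa
      · exact hx j (by simp [hja, hj])
    · rw [ha]
      refine ih _ fun j hj => ?_
      rcases eq_or_ne j a with rfl | hja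
      · rw [Function.update_self]
        revert hxa
        cases x j <;> cases y j <;> simp
      · rw [Function.update_of_ne hja]
        exact hx j (by simp [hja, hj])

lemma IsLocal.phaseDeg {m n d : ℕ} {f : (Fin m → Bool) → Fin n → Bool} (hf : IsLocal d f) :
    PhaseDeg d fun x => ∏ i, sg (f x i) := by
  refine PhaseDeg.prod Finset.univ (fun i x => sg (f x i)) fun i _ => ?_
  obtain ⟨T, hT, h⟩ := hf i
  exact PhaseDeg.of_dep T hT (fun x => sg (f x i)) (fun x => sg_mul_self _)
    fun x y hxy => by rw [h x y hxy]

open scoped Classical in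
lemma IsLocal.sum_card_affects_le {m n d : ℕ} {f : (Fin m → Bool) → Fin n → Bool}
    (hf : IsLocal d f) :
    ∑ j, ((Finset.univ.filter fun i => Affects f j i).card : ℝ) ≤ d * n := by
  have h : ∀ i, (Finset.univ.filter fun j => Affects f j i).card ≤ d := fun i => by
    obtain ⟨T, hT, h⟩ := hf i
    refine (Finset.card_le_card fun j hj => ?_).trans hT
    obtain ⟨x, hx⟩ := (Finset.mem_filter.1 hj).2
    by_contra hjT
    exact hx (h _ _ fun l hl => by
      rw [Function.update_of_ne (by rintro rfl; exact hjT hl)])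
  have h2 : ∑ j, (Finset.univ.filter fun i => Affects f j i).card ≤ d * n := by
    calc ∑ j, (Finset.univ.filter fun i => Affects f j i).card
        = ∑ i, (Finset.univ.filter fun j => Affects f j i).card := by
          simp only [Finset.card_filter]
          exact Finset.sum_comm
      _ ≤ ∑ _i : Fin n, d := Finset.sum_le_sum fun i _ => h i
      _ = d * n := by simp [mul_comm]
  exact_mod_cast h2

lemma KWiseOn.kInd {m n k : ℕ} {f : (Fin m → Bool) → Fin n → Bool} {T : Finset (Fin n)}
    (h : KWiseOn k (pushf f (unifOn (Finset.univ : Finset (Fin m → Bool)))) T) : KInd f T k := by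
  refine kInd_of_prob f T k fun T' hT' hk z => ?_
  rw [← h T' hT' hk z, sum_filter_pushf_unifOn]
  congr!

lemma abs_sub_mul_le_one {p q η : ℝ} (hp0 : 0 ≤ p) (hp1 : p ≤ 1) (hq0 : 0 ≤ q) (hq1 : q ≤ 1)
    (hη0 : 0 ≤ η) (hη1 : η ≤ 1) : |p - η * q| ≤ 1 := by
  have h1 : η * q ≤ 1 := mul_le_one₀ hη1 hq0 hq1
  have h2 : 0 ≤ η * q := mul_nonneg hη0 hq0
  rw [abs_le]
  constructor <;> linarith

lemma expect_ite_mem_Icc {α : Type} [Fintype α] [Nonempty α] (p : α → Prop) [DecidablePred p] :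
    (0 : ℝ) ≤ (𝔼 x, if p x then (1 : ℝ) else 0) ∧ (𝔼 x, if p x then (1 : ℝ) else 0) ≤ (1 : ℝ) :=
  ⟨Finset.expect_nonneg fun x _ => by split_ifs <;> norm_num,
    Finset.expect_le Finset.univ_nonempty fun x _ => by split_ifs <;> norm_num⟩

lemma one_le_error {δ A : ℝ} {k K : ℕ} (hk : 2 ≤ k) (hA : 0 < A) (hδ : 0 < δ) (hδ1 : δ < 1 / 2)
    (h : 1 / 16 < δ ∨ k < 12 ∨ A < 32) :
    1 ≤ 20000 * (Real.log (1 / δ) ^ K / √(A * δ) + Real.log k / √k + δ) := by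
  have hL0 : 0 ≤ Real.log (1 / δ) := Real.log_nonneg (by rw [le_div_iff₀ hδ]; linarith)
  have h1 : 0 ≤ Real.log (1 / δ) ^ K / √(A * δ) := by positivity
  have hlk : Real.log 2 ≤ Real.log k := Real.log_le_log (by norm_num) (by exact_mod_cast hk)
  have hlog := Real.log_two_gt_d9
  have hk0 : (0 : ℝ) < k := by exact_mod_cast (by omega : 0 < k)
  have h2 : 0 ≤ Real.log k / √k := div_nonneg (by linarith) (Real.sqrt_nonneg _)
  by_cases hδ16 : 1 / 16 < δ
  · linarith
  push Not at hδ16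
  by_cases hk12 : k < 12
  · have : 1 / 10 ≤ Real.log k / √k := by
      rw [div_le_div_iff₀ (by norm_num) (Real.sqrt_pos.2 hk0)]
      have : √(k : ℝ) ≤ 4 := by
        rw [Real.sqrt_le_iff]
        have : (k : ℝ) ≤ 12 := by exact_mod_cast hk12.le
        norm_num
        linarith
      linarith
    linarith
  have hA32 : A < 32 := (h.resolve_left hδ16.not_gt).resolve_left hk12
  have hL1 : 1 ≤ Real.log (1 / δ) := by
    rw [Real.le_log_iff_exp_le (by positivity), le_div_iff₀ hδ]
    nlinarith [Real.exp_one_lt_d9]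
  have : 1 / 2 ≤ Real.log (1 / δ) ^ K / √(A * δ) := by
    have : 0 < A * δ := by positivity
    gcongr
    · exact one_le_pow₀ hL1
    · rw [Real.sqrt_le_iff]
      constructor
      · norm_num
      · nlinarith
  linarith

lemma le_card_of_kInd {m n k : ℕ} {A : ℝ} {f : (Fin m → Bool) → Fin n → Bool} (hk : 1 ≤ k)
    (hA : 0 < A) (hn : 1 ≤ n) {Nb : Fin m → Finset (Fin n)}
    (hNb : ∀ j i, Affects f j i → i ∈ Nb j) (hdeg : ∀ j, ((Nb j).card : ℝ) ≤ n / A)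
    {S : Finset (Fin n)} (hS : (S.card : ℝ) ≤ √(n / A)) (h : KInd f Sᶜ k) : A ≤ n := by
  by_contra! hlt
  have h1 : (n : ℝ) / A < 1 := (div_lt_one hA).2 hlt
  have hS0 : S = ∅ := by
    have : (S.card : ℝ) < 1 := hS.trans_lt ((Real.sqrt_lt' one_pos).2 (by simpa using h1))
    exact Finset.card_eq_zero.1 (by exact_mod_cast Nat.lt_one_iff.1 (by exact_mod_cast this))
  have hNb0 : ∀ j, Nb j = ∅ := fun j => by
    have : ((Nb j).card : ℝ) < 1 := (hdeg j).trans_lt h1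
    exact Finset.card_eq_zero.1 (by exact_mod_cast Nat.lt_one_iff.1 (by exact_mod_cast this))
  let i : Fin n := ⟨0, hn⟩
  have hconst := eq_of_forall_not_affects (f := f) (i := i) fun j hj => by
    have := hNb j i hj
    simp [hNb0] at this
  have hbal := h {i} (by simp [hS0]) (by simpa using hk) (fun u => sg (u i))
    fun u v huv => by rw [huv i (by simp)]
  have hflip : 𝔼 u : Fin n → Bool, sg (u i) = 0 := by
    have := expect_flip (fun u : Fin n → Bool => sg (u i)) i
    simp only [Function.update_self] at this
    have h2 : ∀ b, sg (!b) = - sg b := by intro b; cases b <;> simp [sg]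
    simp only [h2, Finset.expect_neg_distrib] at this
    linarith
  rw [hflip, Finset.expect_congr rfl fun x _ => by rw [hconst x fun _ => false],
    Finset.expect_const Finset.univ_nonempty] at hbal
  have := sg_mul_self (f (fun _ => false) i)
  rw [hbal] at this
  norm_num at this

lemma abs_half_combination_le {p g r e q R s : ℝ} (hs : |s| = 1) (h1 : |p - q| ≤ R)
    (h2 : |g - e * q| ≤ R) (hr : r = (p + s * g) / 2) : |r - (1 + s * e) / 2 * q| ≤ R := by
  have : r - (1 + s * e) / 2 * q = ((p - q) + s * (g - e * q)) / 2 := by rw [hr]; ring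
  rw [this, abs_div, abs_two]
  have := abs_add_le (p - q) (s * (g - e * q))
  rw [abs_mul, hs] at this
  linarith

lemma expect_parity {m n : ℕ} (f : (Fin m → Bool) → Fin n → Bool) (t : ℝ) :
    (𝔼 x, (if t < (hw (f x) : ℝ) ∧ Even (hw (f x)) then (1 : ℝ) else 0)) =
      ((𝔼 x, if t < (hw (f x) : ℝ) then (1 : ℝ) else 0) +
        1 * 𝔼 x, (∏ i, sg (f x i)) * if t < (hw (f x) : ℝ) then (1 : ℝ) else 0) / 2 ∧
    (𝔼 x, (if t < (hw (f x) : ℝ) ∧ Odd (hw (f x)) then (1 : ℝ) else 0)) =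
      ((𝔼 x, if t < (hw (f x) : ℝ) then (1 : ℝ) else 0) +
        (-1) * 𝔼 x, (∏ i, sg (f x i)) * if t < (hw (f x) : ℝ) then (1 : ℝ) else 0) / 2 := by
  simp only [Finset.mul_expect, ← Finset.expect_add_distrib, Finset.expect_div, prod_sg_eq]
  constructor <;> refine Finset.expect_congr rfl fun x _ => ?_
  all_goals
    rcases Nat.even_or_odd (hw (f x)) with h | h
    · by_cases ht : t < (hw (f x) : ℝ) <;> simp [h, ht, h.neg_one_pow]
    · by_cases ht : t < (hw (f x) : ℝ) <;> simp [h, ht, h.neg_one_pow]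

end Translation

end Library

open scoped Classical in
/-- Kolmogorov bound for nearly `k`-wise independent local sources with small input degrees. -/
theorem stmt4 :
    ∃ C : ℝ, 0 < C ∧ ∃ N₀ : ℕ, ∀ d : ℕ, 1 ≤ d → ∃ K : ℕ,
    ∀ k : ℕ, 2 ≤ k → ∀ A : ℝ, 0 < A → ∀ n : ℕ, N₀ ≤ n → ∀ m : ℕ,
    ∀ f : (Fin m → Bool) → (Fin n → Bool), IsLocal d f →
    (∀ j : Fin m, ((Finset.univ.filter fun i : Fin n => Affects f j i).card : ℝ) ≤ n / A) →
    (∃ S : Finset (Fin n), (S.card : ℝ) ≤ Real.sqrt (n / A) ∧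
      KWiseOn k (pushf f (unifOn (Finset.univ : Finset (Fin m → Bool)))) Sᶜ) →
    ∃ η : ℝ, 0 ≤ η ∧ η ≤ 1 ∧ ∀ δ : ℝ, 0 < δ → δ < 1 / 2 → ∀ t : ℝ,
      |(∑ y ∈ Finset.univ.filter
            (fun y : Fin n → Bool => t < (hw y : ℝ) ∧ Even (hw y)),
            pushf f (unifOn (Finset.univ : Finset (Fin m → Bool))) y)
          - η * (((Finset.univ.filter fun y : Fin n → Bool => t < (hw y : ℝ)).card : ℝ) / 2 ^ n)|
        ≤ C * ((Real.log (1 / δ)) ^ K / Real.sqrt (A * δ) + Real.log k / Real.sqrt k + δ) ∧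
      |(∑ y ∈ Finset.univ.filter
            (fun y : Fin n → Bool => t < (hw y : ℝ) ∧ Odd (hw y)),
            pushf f (unifOn (Finset.univ : Finset (Fin m → Bool))) y)
          - (1 - η) * (((Finset.univ.filter fun y : Fin n → Bool => t < (hw y : ℝ)).card : ℝ) / 2 ^ n)|
        ≤ C * ((Real.log (1 / δ)) ^ K / Real.sqrt (A * δ) + Real.log k / Real.sqrt k + δ) := by
  refine ⟨20000, by norm_num, 1, fun d hd => ?_⟩
  obtain ⟨K, hK⟩ := exists_local_tail_bounds hd
  refine ⟨K, ?_⟩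
  rintro k hk A hA n hn m f hf hdeg ⟨S, hS, hind⟩
  have hI := hind.kInd
  have hG := hf.phaseDeg
  have hη : |Finset.univ.expect fun x => ∏ i, sg (f x i)| ≤ 1 := (Finset.abs_expect_le _ _).trans
    (Finset.expect_le Finset.univ_nonempty fun x _ => (hG.abs_eq x).le)
  set e := Finset.univ.expect fun x => ∏ i, sg (f x i)
  rw [abs_le] at hη
  refine ⟨(1 + 1 * e) / 2, by linarith, by linarith, fun δ hδ hδ1 t => ?_⟩
  have hodd : 1 - (1 + 1 * e) / 2 = (1 + (-1) * e) / 2 := by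
    ring
  rw [hodd, sum_filter_pushf_unifOn, sum_filter_pushf_unifOn, card_filter_div_two_pow]
  by_cases htriv : 1 / 16 < δ ∨ k < 12 ∨ A < 32
  · have hR := one_le_error (K := K) hk hA hδ hδ1 htriv
    obtain ⟨h0, h1⟩ := expect_ite_mem_Icc fun y : Fin n → Bool => t < (hw y : ℝ)
    obtain ⟨h2, h3⟩ := expect_ite_mem_Icc fun x => t < (hw (f x) : ℝ) ∧ Even (hw (f x))
    obtain ⟨h4, h5⟩ := expect_ite_mem_Icc fun x => t < (hw (f x) : ℝ) ∧ Odd (hw (f x))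
    exact ⟨(abs_sub_mul_le_one h2 h3 h0 h1 (by linarith) (by linarith)).trans hR,
      (abs_sub_mul_le_one h4 h5 h0 h1 (by linarith) (by linarith)).trans hR⟩
  push Not at htriv
  obtain ⟨hδ16, hk12, hA32⟩ := htriv
  have hAn := le_card_of_kInd (by omega) hA hn
    (fun j i hj => Finset.mem_filter.2 ⟨Finset.mem_univ i, hj⟩) hdeg hS hI
  obtain ⟨h1, h2⟩ := hK (Fin m) (Fin n) f Sᶜ k (fun j => Finset.univ.filter fun i => Affects f j i)
    _ A δ t hI hk12 (fun x j i hi => by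
      by_contra hne
      exact hi (Finset.mem_filter.2 ⟨Finset.mem_univ i, x, fun h => hne h.symm⟩)) hG hA32
    (by simpa using hAn) (by simpa using hdeg) (by simpa using hf.sum_card_affects_le)
    (by
      rw [Finset.card_compl, Fintype.card_fin, Nat.sub_sub_self (by simpa using S.card_le_univ)]
      exact hS) hδ hδ16
  obtain ⟨heven, hodd⟩ := expect_parity f t
  exact ⟨abs_half_combination_le (by simp) h1 h2 heven,
    abs_half_combination_le (by simp) h1 h2 hodd⟩
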